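/- For every integer d ≥ 2, there exist number fields K and K' that are not isomorphic as fields, a central division algebra A of degree d over K and a central division algebra A' of degree d over K', such that: (i) for every finite-dimensional central simple ℚ-algebra B, B lies in the fiber (Res_{K/ℚ})⁻¹(A) if and only if B lies in the fiber (Res_{K'/ℚ})⁻¹(A'); and (ii) there exists at least one finite-dimensional central simple ℚ-algebra B₀ lying in both fibers. -/

import Mathlib

open TensorProduct

/-- A bundled finite-dimensional central simple algebra over the field `k`. -/
structure CSAlg (k : Type) [Field k] : Type 1 where
  carrier : Type
  [ring : Ring carrier]
  [alg : Algebra k carrier]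
  finiteDimensional : FiniteDimensional k carrier
  isSimpleRing : IsSimpleRing carrier
  center_le_bot : Subalgebra.center k carrier ≤ ⊥

attribute [instance] CSAlg.ring CSAlg.alg

/-- `A` is a division algebra. -/
def CSAlg.IsDivision {k : Type} [Field k] (A : CSAlg k) : Prop :=
  ∀ x : A.carrier, x ≠ 0 → IsUnit x

/-- `A` has degree `d`, i.e. dimension `d ^ 2` over the base field. -/
def CSAlg.DegreeEq {k : Type} [Field k] (A : CSAlg k) (d : ℕ) : Prop :=
  Module.finrank k A.carrier = d ^ 2

/-- Brauer equivalence of two `k`-algebras: some matrix algebras over them are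
isomorphic as `k`-algebras. -/
def IsBrauerEquiv (k : Type) [Field k] (A : Type) [Ring A] [Algebra k A]
    (B : Type) [Ring B] [Algebra k B] : Prop :=
  ∃ n m : ℕ, 0 < n ∧ 0 < m ∧
    Nonempty (Matrix (Fin n) (Fin n) A ≃ₐ[k] Matrix (Fin m) (Fin m) B)

/-- A central simple `F`-algebra `B` lies in the fiber `(Res_{K/F})⁻¹(A)` if
`B ⊗[F] K` is Brauer-equivalent to `A` over `K`. -/
def InFiber (F : Type) [Field F] (K : Type) [Field K] [Algebra F K]
    (A : CSAlg K) (B : CSAlg F) : Prop :=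
  IsBrauerEquiv K (K ⊗[F] B.carrier) A.carrier

/-- A bundled number field. -/
structure NumField : Type 1 where
  carrier : Type
  [field : Field carrier]
  [numberField : NumberField carrier]

attribute [instance] NumField.field NumField.numberField

section

open TensorProduct

theorem isSimpleRing_tensorProduct {k A C : Type*} [Field k] [Ring A] [Ring C] [Algebra k A]
    [Algebra k C] [IsSimpleRing A] [IsSimpleRing C] (hA : Subalgebra.center k A ≤ ⊥) :
    IsSimpleRing (A ⊗[k] C) := by
  classical
  let b := Module.Basis.ofVectorSpace k C
  let β := Algebra.TensorProduct.basis A b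
  have : Nontrivial (A ⊗[k] C) := inferInstance
  refine ⟨⟨fun I ↦ or_iff_not_imp_left.mpr fun hI ↦ ?_⟩⟩
  have hl : ∀ (a : A) (x : A ⊗[k] C) j, β.repr (a ⊗ₜ[k] (1 : C) * x) j = a * β.repr x j := by
    intro a x j
    have : a ⊗ₜ[k] (1 : C) * x = a • x := by
      induction x using TensorProduct.induction_on with
      | zero => simp
      | add x y hx hy => rw [mul_add, hx, hy, smul_add]
      | tmul a' c => rw [Algebra.TensorProduct.tmul_mul_tmul, one_mul, smul_tmul', smul_eq_mul]
    rw [this]; simp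
  have hr : ∀ (a : A) (x : A ⊗[k] C) j, β.repr (x * a ⊗ₜ[k] (1 : C)) j = β.repr x j * a := by
    intro a x j
    induction x using TensorProduct.induction_on with
    | zero => simp
    | add x y hx hy => simp [add_mul, hx, hy]
    | tmul a' c =>
      rw [Algebra.TensorProduct.tmul_mul_tmul, mul_one]
      simp only [β, Algebra.TensorProduct.basis_repr_tmul, Finsupp.smul_apply, smul_eq_mul,
        Finsupp.mapRange_apply]
      rw [mul_assoc, mul_assoc, Algebra.commutes]
  obtain ⟨x, hxI, hx0, hmin⟩ : ∃ x ∈ I, x ≠ 0 ∧ ∀ y ∈ I, y ≠ 0 →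
      (β.repr x).support.card ≤ (β.repr y).support.card := by
    have hex : ∃ x, x ∈ I ∧ x ≠ 0 := by
      by_contra! h
      exact hI (eq_bot_iff.mpr fun x hx ↦ by simpa using h x hx)
    let S : Set (A ⊗[k] C) := {x | x ∈ I ∧ x ≠ 0}
    obtain ⟨x, hx, hm⟩ := (measure fun x : A ⊗[k] C ↦ (β.repr x).support.card).wf.has_min S hex
    exact ⟨x, hx.1, hx.2, fun y hy hy0 ↦ not_lt.mp (hm y ⟨hy, hy0⟩)⟩
  obtain ⟨j, hj⟩ : ∃ j, β.repr x j ≠ 0 := by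
    by_contra! h
    exact hx0 (β.repr.map_eq_zero_iff.mp (Finsupp.ext h))
  let J : TwoSidedIdeal A := TwoSidedIdeal.mk'
    {a | ∃ y ∈ I, (β.repr y).support ⊆ (β.repr x).support ∧ β.repr y j = a}
    ⟨0, I.zero_mem, by simp, by simp⟩
    (by
      rintro _ _ ⟨y, hy, hs, rfl⟩ ⟨z, hz, ht, rfl⟩
      refine ⟨y + z, I.add_mem hy hz, ?_, by simp⟩
      rw [map_add]
      exact Finsupp.support_add.trans (Finset.union_subset hs ht))
    (by
      rintro _ ⟨y, hy, hs, rfl⟩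
      exact ⟨-y, I.neg_mem hy, by simpa [Finsupp.support_neg] using hs, by simp⟩)
    (by
      rintro a _ ⟨y, hy, hs, rfl⟩
      refine ⟨a ⊗ₜ 1 * y, I.mul_mem_left _ _ hy, fun i hi ↦ hs ?_, hl _ _ _⟩
      rw [Finsupp.mem_support_iff] at hi ⊢
      rw [hl] at hi
      exact right_ne_zero_of_mul hi)
    (by
      rintro _ a ⟨y, hy, hs, rfl⟩
      refine ⟨y * a ⊗ₜ 1, I.mul_mem_right _ _ hy, fun i hi ↦ hs ?_, hr _ _ _⟩
      rw [Finsupp.mem_support_iff] at hi ⊢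
      rw [hr] at hi
      exact left_ne_zero_of_mul hi)
  have hJ : J = ⊤ := by
    refine (eq_bot_or_eq_top J).resolve_left fun h ↦ hj ?_
    have : β.repr x j ∈ J := by
      rw [TwoSidedIdeal.mem_mk']
      exact ⟨x, hxI, subset_rfl, rfl⟩
    rw [h] at this
    simpa using this
  obtain ⟨y, hyI, hys, hyj⟩ : (1 : A) ∈ {a | ∃ y ∈ I, (β.repr y).support ⊆ (β.repr x).support ∧
      β.repr y j = a} := by
    have : (1 : A) ∈ J := by rw [hJ]; trivial
    rwa [TwoSidedIdeal.mem_mk'] at this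
  have hcomm : ∀ a : A, a ⊗ₜ[k] (1 : C) * y = y * a ⊗ₜ[k] (1 : C) := by
    intro a
    by_contra h
    have h1 := hmin _ (I.sub_mem (I.mul_mem_left (a ⊗ₜ[k] (1 : C)) _ hyI)
      (I.mul_mem_right _ (a ⊗ₜ[k] (1 : C)) hyI)) (sub_ne_zero.mpr h)
    refine absurd h1 (not_le.mpr (Finset.card_lt_card ⟨?_, ?_⟩))
    · intro i hi
      by_contra hi'
      have : β.repr y i = 0 := by
        by_contra h0
        exact hi' (hys (Finsupp.mem_support_iff.mpr h0))
      simp [hl, hr, this] at hi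
    · intro hsub
      have := hsub (Finsupp.mem_support_iff.mpr hj)
      simp [hl, hr, hyj] at this
  have hcen : ∀ i, ∃ c : k, algebraMap k A c = β.repr y i := by
    intro i
    have : β.repr y i ∈ Subalgebra.center k A := by
      rw [Subalgebra.mem_center_iff]
      intro a
      rw [← hl, ← hr, hcomm]
    exact Algebra.mem_bot.mp (hA this)
  choose c hc using hcen
  have hy : ∃ z : C, y = 1 ⊗ₜ z := by
    refine ⟨∑ i ∈ (β.repr y).support, c i • b i, ?_⟩
    rw [TensorProduct.tmul_sum]
    conv_lhs => rw [← β.linearCombination_repr y, Finsupp.linearCombination_apply, Finsupp.sum]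
    refine Finset.sum_congr rfl fun i _ ↦ ?_
    rw [← hc, Algebra.TensorProduct.basis_apply, TensorProduct.tmul_smul, algebraMap_smul]
  obtain ⟨z, rfl⟩ := hy
  have hz : z ≠ 0 := by
    rintro rfl
    simp at hyj
  have hcomap : (I.comap (Algebra.TensorProduct.includeRight : C →ₐ[k] A ⊗[k] C)) = ⊤ := by
    refine (eq_bot_or_eq_top _).resolve_left fun h ↦ hz ?_
    have : z ∈ I.comap (Algebra.TensorProduct.includeRight : C →ₐ[k] A ⊗[k] C) := by
      rw [TwoSidedIdeal.mem_comap]; exact hyI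
    rw [h] at this
    simpa using this
  have h1 : (1 : C) ∈ I.comap (Algebra.TensorProduct.includeRight : C →ₐ[k] A ⊗[k] C) := by
    rw [hcomap]; trivial
  rw [TwoSidedIdeal.mem_comap, map_one] at h1
  exact TwoSidedIdeal.one_mem_iff I |>.mp h1

end

section

open TensorProduct

/-- Matrices over `D` as endomorphisms of a free right `D`-module. -/
noncomputable def matrixEquivEndMop (F D : Type) [CommSemiring F] [Ring D] [Algebra F D] (m : ℕ) :
    Matrix (Fin m) (Fin m) D ≃ₐ[F] Module.End Dᵐᵒᵖ (Fin m → Dᵐᵒᵖ) :=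
  ((AlgEquiv.opOp F D).trans (AlgEquiv.moduleEndSelf F)).mapMatrix.trans
    (endVecAlgEquivMatrixEnd (Fin m) F Dᵐᵒᵖ Dᵐᵒᵖ).symm

theorem exists_module_of_coprime {F R M₁ M₂ : Type} [Field F] [Ring R] [Algebra F R]
    [FiniteDimensional F R] [IsSimpleRing R]
    [AddCommGroup M₁] [Module F M₁] [FiniteDimensional F M₁]
    [AddCommGroup M₂] [Module F M₂] [FiniteDimensional F M₂]
    (ρ₁ : R →ₐ[F] Module.End F M₁) (ρ₂ : R →ₐ[F] Module.End F M₂)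
    {a b N : ℕ} (hab : a.Coprime b) (hN : N ≠ 0) (h₁ : Module.finrank F M₁ = a * N)
    (h₂ : Module.finrank F M₂ = b * N) :
    ∃ (M : Type) (_ : AddCommGroup M) (_ : Module F M) (_ : FiniteDimensional F M)
      (_ : R →ₐ[F] Module.End F M), Module.finrank F M = N := by
  have : IsArtinianRing R := IsArtinianRing.of_finite F R
  let m₁ : Module R M₁ := Module.compHom M₁ ρ₁.toRingHom
  let m₂ : Module R M₂ := Module.compHom M₂ ρ₂.toRingHom
  have : IsScalarTower F R M₁ := ⟨fun c r x ↦ by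
    change ρ₁ (c • r) x = c • ρ₁ r x
    simp⟩
  have : IsScalarTower F R M₂ := ⟨fun c r x ↦ by
    change ρ₂ (c • r) x = c • ρ₂ r x
    simp⟩
  have : Module.Finite R M₁ := Module.Finite.of_restrictScalars_finite F R M₁
  have : Module.Finite R M₂ := Module.Finite.of_restrictScalars_finite F R M₂
  have hne : Nontrivial (M₁ × M₂) := by
    by_contra h
    rw [not_nontrivial_iff_subsingleton] at h
    have h3 : Module.finrank F M₁ = 0 := by
      have : Subsingleton M₁ := (LinearMap.inl_injective (R := F) (M := M₁) (M₂ := M₂)).subsingleton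
      exact Module.finrank_zero_of_subsingleton
    have h4 : Module.finrank F M₂ = 0 := by
      have : Subsingleton M₂ := (LinearMap.inr_injective (R := F) (M := M₁) (M₂ := M₂)).subsingleton
      exact Module.finrank_zero_of_subsingleton
    rw [h3] at h₁
    rw [h4] at h₂
    have : a = 0 := by simpa [hN] using h₁.symm
    have : b = 0 := by simpa [hN] using h₂.symm
    subst a b
    simp at hab
  obtain ⟨S, hS⟩ := IsSemisimpleModule.exists_simple_submodule R (M₁ × M₂)
  have hT : IsIsotypicOfType R (M₁ × M₂) S := IsSimpleRing.isIsotypic R (M₁ × M₂) S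
  obtain ⟨n₁, ⟨e₁⟩⟩ := (hT.of_injective (LinearMap.inl R M₁ M₂)
    LinearMap.inl_injective).linearEquiv_fun
  obtain ⟨n₂, ⟨e₂⟩⟩ := (hT.of_injective (LinearMap.inr R M₁ M₂)
    LinearMap.inr_injective).linearEquiv_fun
  have : Module.Finite F S := Module.Finite.of_injective (S.subtype.restrictScalars F)
    S.subtype_injective
  have d₁ : a * N = n₁ * Module.finrank F S := by
    rw [← h₁, (e₁.restrictScalars F).finrank_eq, Module.finrank_pi_fintype]; simp
  have d₂ : b * N = n₂ * Module.finrank F S := by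
    rw [← h₂, (e₂.restrictScalars F).finrank_eq, Module.finrank_pi_fintype]; simp
  obtain ⟨t, ht⟩ : Module.finrank F S ∣ N := by
    have h := Nat.dvd_gcd (Dvd.intro_left _ d₁.symm) (Dvd.intro_left _ d₂.symm)
    rwa [Nat.gcd_mul_right, hab.gcd_eq_one, one_mul] at h
  exact ⟨Fin t → S, inferInstance, inferInstance, inferInstance, Algebra.lsmul F F _, by
    rw [Module.finrank_pi_fintype, ht]; simp [mul_comm]⟩

/-- Let `D` be a division algebra over `k`. If a central simple algebra `B` over `F` acts on a
right `D`-space of suitable dimension after two extensions of `D` of coprime degrees, then it is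
split by `D` in the sense that `k ⊗ B` is a matrix algebra over `D`. -/
theorem nonempty_algEquiv_matrix_of_coprime {F k D B D₁ D₂ : Type} [Field F] [Field k]
    [Algebra F k] [FiniteDimensional F k] [Ring D] [Algebra k D] [Algebra F D]
    [IsScalarTower F k D] [FiniteDimensional k D] [Nontrivial D]
    (hD : ∀ x : D, x ≠ 0 → IsUnit x) [Ring B] [Algebra F B] [FiniteDimensional F B]
    [IsSimpleRing B] (hB : Subalgebra.center F B ≤ ⊥) [Ring D₁] [Algebra F D₁]
    [FiniteDimensional F D₁] [Ring D₂] [Algebra F D₂] [FiniteDimensional F D₂]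
    {m a b : ℕ} (hm : m ≠ 0) (hab : a.Coprime b)
    (h₁ : Module.finrank F D₁ = a * Module.finrank F D)
    (h₂ : Module.finrank F D₂ = b * Module.finrank F D)
    (f₁ : B →ₐ[F] Matrix (Fin m) (Fin m) D₁) (f₂ : B →ₐ[F] Matrix (Fin m) (Fin m) D₂)
    (g₁ : D →ₐ[F] D₁) (g₂ : D →ₐ[F] D₂)
    (hdim : Module.finrank F B = m ^ 2 * Module.finrank k D) :
    Nonempty (k ⊗[F] B ≃ₐ[k] Matrix (Fin m) (Fin m) D) := by
  classical
  let _ : DivisionRing D := { ‹Ring D›, DivisionRing.ofIsUnitOrEqZero (R := D) fun a ↦ by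
    by_cases h : a = 0
    · exact Or.inr h
    · exact Or.inl (hD a h) with }
  have : FiniteDimensional F D := FiniteDimensional.trans F k D
  have : IsSimpleRing (B ⊗[F] Dᵐᵒᵖ) := isSimpleRing_tensorProduct hB
  have act : ∀ (D' : Type) [Ring D'] [Algebra F D'] [FiniteDimensional F D']
      (f : B →ₐ[F] Matrix (Fin m) (Fin m) D') (g : D →ₐ[F] D'),
      ∃ _ : B ⊗[F] Dᵐᵒᵖ →ₐ[F] Module.End F (Fin m → D'ᵐᵒᵖ), True := by
    intro D' _ _ _ f g
    let e := matrixEquivEndMop F D' m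
    let r : Module.End D'ᵐᵒᵖ (Fin m → D'ᵐᵒᵖ) →ₐ[F] Module.End F (Fin m → D'ᵐᵒᵖ) :=
      AlgHom.ofLinearMap
        { toFun := fun t ↦ t.restrictScalars F
          map_add' := fun _ _ ↦ rfl
          map_smul' := fun _ _ ↦ rfl } rfl fun _ _ ↦ rfl
    refine ⟨Algebra.TensorProduct.lift (r.comp (e.toAlgHom.comp f))
      ((Algebra.lsmul F F (Fin m → D'ᵐᵒᵖ)).comp (AlgHom.op g)) fun x y ↦ ?_, trivial⟩
    refine LinearMap.ext fun v ↦ ?_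
    exact map_smul (e (f x)) (AlgHom.op g y) v
  obtain ⟨ρ₁, -⟩ := act D₁ f₁ g₁
  obtain ⟨ρ₂, -⟩ := act D₂ f₂ g₂
  have hfr : ∀ (D' : Type) [Ring D'] [Algebra F D'] [FiniteDimensional F D'] (a : ℕ),
      Module.finrank F D' = a * Module.finrank F D →
      Module.finrank F (Fin m → D'ᵐᵒᵖ) = a * (m * Module.finrank F D) := by
    intro D' _ _ _ a h
    rw [Module.finrank_pi_fintype, ← (MulOpposite.opLinearEquiv F (M := D')).finrank_eq, h]
    simp; ring
  obtain ⟨M, _, _, _, ρ, hM⟩ := exists_module_of_coprime ρ₁ ρ₂ hab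
    (mul_ne_zero hm Module.finrank_pos.ne') (hfr D₁ a h₁) (hfr D₂ b h₂)
  let ρD : Dᵐᵒᵖ →ₐ[F] Module.End F M := ρ.comp Algebra.TensorProduct.includeRight
  let ρB : B →ₐ[F] Module.End F M := ρ.comp Algebra.TensorProduct.includeLeft
  have hcomm : ∀ x y v, ρB x (ρD y v) = ρD y (ρB x v) := by
    intro x y v
    have : ρB x * ρD y = ρD y * ρB x := by
      simp only [ρB, ρD, AlgHom.comp_apply, ← map_mul]
      simp
    exact LinearMap.congr_fun this v
  let _ : Module Dᵐᵒᵖ M := Module.compHom M ρD.toRingHom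
  have : IsScalarTower F Dᵐᵒᵖ M := ⟨fun c r x ↦ by
    change ρD (c • r) x = c • ρD r x
    simp⟩
  have : Module.Finite Dᵐᵒᵖ M := Module.Finite.of_restrictScalars_finite F Dᵐᵒᵖ M
  have hMD : Module.finrank Dᵐᵒᵖ M = m := by
    have := Module.finrank_mul_finrank F Dᵐᵒᵖ M
    rw [hM, ← (MulOpposite.opLinearEquiv F (M := D)).finrank_eq, mul_comm] at this
    exact Nat.eq_of_mul_eq_mul_right Module.finrank_pos this
  let e : M ≃ₗ[Dᵐᵒᵖ] (Fin m → Dᵐᵒᵖ) :=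
    LinearEquiv.ofFinrankEq M (Fin m → Dᵐᵒᵖ) (by rw [hMD]; simp)
  let β : B →ₐ[F] Module.End Dᵐᵒᵖ M :=
    AlgHom.ofLinearMap
      { toFun := fun x ↦ { ρB x with map_smul' := fun y v ↦ hcomm x y v }
        map_add' := fun x y ↦ by ext v; exact LinearMap.congr_fun (map_add ρB x y) v
        map_smul' := fun c x ↦ by ext v; exact LinearMap.congr_fun (map_smul ρB c x) v }
      (by ext v; exact LinearMap.congr_fun (map_one ρB) v)
      (fun x y ↦ by ext v; exact LinearMap.congr_fun (map_mul ρB x y) v)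
  let γ : B →ₐ[F] Matrix (Fin m) (Fin m) D :=
    (matrixEquivEndMop F D m).symm.toAlgHom.comp ((e.conjAlgEquiv F).toAlgHom.comp β)
  let δ : k ⊗[F] B →ₐ[k] Matrix (Fin m) (Fin m) D :=
    Algebra.TensorProduct.lift (Algebra.ofId k _) γ fun x y ↦ Algebra.commutes x (γ y)
  have : Nonempty (Fin m) := ⟨⟨0, Nat.pos_of_ne_zero hm⟩⟩
  have : IsSimpleRing (B ⊗[F] k) := isSimpleRing_tensorProduct hB
  have : IsSimpleRing (k ⊗[F] B) :=
    .of_ringEquiv (Algebra.TensorProduct.comm F B k).toRingEquiv this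
  have hinj : Function.Injective δ := RingHom.injective δ.toRingHom
  refine ⟨AlgEquiv.ofBijective δ ⟨hinj, ?_⟩⟩
  refine (LinearMap.injective_iff_surjective_of_finrank_eq_finrank (f := δ.toLinearMap) ?_).mp hinj
  rw [Module.finrank_baseChange, hdim, Module.finrank_matrix]
  rw [Fintype.card_fin, pow_two]

end

section

open TensorProduct

/-- Base change of a matrix algebra. -/
noncomputable def matrixBaseChange (F K B : Type) [Field F] [Field K] [Algebra F K] [Ring B]
    [Algebra F B] (n : ℕ) :
    K ⊗[F] Matrix (Fin n) (Fin n) B ≃ₐ[K] Matrix (Fin n) (Fin n) (K ⊗[F] B) :=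
  (Algebra.TensorProduct.congr (Matrix.uniqueAlgEquiv (m := Unit) (R := K) (A := K)).symm
    AlgEquiv.refl).trans ((Matrix.kroneckerTMulAlgEquiv Unit (Fin n) F K K B).trans
      (Matrix.reindexAlgEquiv K (K ⊗[F] B) (Equiv.punitProd (Fin n))))

theorem IsBrauerEquiv.of_coprime {F K K' L₁ L₂ B B₀ : Type} [Field F] [Field K] [Field K']
    [Field L₁] [Field L₂] [Algebra F K] [Algebra F K'] [Algebra F L₁] [Algebra F L₂]
    [FiniteDimensional F K'] [FiniteDimensional F L₁] [FiniteDimensional F L₂]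
    [Ring B] [Algebra F B] [FiniteDimensional F B] [IsSimpleRing B]
    (hB : Subalgebra.center F B ≤ ⊥) [Ring B₀] [Algebra F B₀] [FiniteDimensional F B₀]
    [Nontrivial B₀] (hdiv : ∀ x : K' ⊗[F] B₀, x ≠ 0 → IsUnit x)
    (i₁ : K →ₐ[F] L₁) (i₂ : K →ₐ[F] L₂) (j₁ : K' →ₐ[F] L₁) (j₂ : K' →ₐ[F] L₂)
    {a b : ℕ} (hab : a.Coprime b)
    (h₁ : Module.finrank F L₁ = a * Module.finrank F K')
    (h₂ : Module.finrank F L₂ = b * Module.finrank F K')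
    (h : IsBrauerEquiv K (K ⊗[F] B) (K ⊗[F] B₀)) :
    IsBrauerEquiv K' (K' ⊗[F] B) (K' ⊗[F] B₀) := by
  obtain ⟨n, m, hn, hm, ⟨e⟩⟩ := h
  have : NeZero n := ⟨hn.ne'⟩
  have hc : Subalgebra.center F (Matrix (Fin n) (Fin n) B) ≤ ⊥ := by
    rw [Matrix.subalgebraCenter_eq_scalarAlgHom_map]
    rintro _ ⟨x, hx, rfl⟩
    obtain ⟨c, rfl⟩ := Algebra.mem_bot.mp (hB hx)
    exact Algebra.mem_bot.mpr ⟨c, ((Matrix.scalarAlgHom (Fin n) F).commutes c).symm⟩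
  have hf : ∀ (L : Type) [Field L] [Algebra F L] (i : K →ₐ[F] L),
      ∃ _ : Matrix (Fin n) (Fin n) B →ₐ[F] Matrix (Fin m) (Fin m) (L ⊗[F] B₀), True :=
    fun L _ _ i ↦ ⟨(Algebra.TensorProduct.map i (AlgHom.id F B₀)).mapMatrix.comp
      ((e.toAlgHom.restrictScalars F).comp
        (Algebra.TensorProduct.includeRight : B →ₐ[F] K ⊗[F] B).mapMatrix), trivial⟩
  obtain ⟨f₁, -⟩ := hf L₁ i₁
  obtain ⟨f₂, -⟩ := hf L₂ i₂
  have hd : n ^ 2 * Module.finrank F B = m ^ 2 * Module.finrank F B₀ := by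
    have := e.toLinearEquiv.finrank_eq
    rw [Module.finrank_matrix, Module.finrank_matrix, Module.finrank_baseChange,
      Module.finrank_baseChange] at this
    simpa only [Fintype.card_fin, ← pow_two] using this
  obtain ⟨E⟩ := nonempty_algEquiv_matrix_of_coprime (F := F) (k := K') (D := K' ⊗[F] B₀)
    (D₁ := L₁ ⊗[F] B₀) (D₂ := L₂ ⊗[F] B₀) hdiv hc hm.ne' hab
    (by rw [Module.finrank_tensorProduct, Module.finrank_tensorProduct, h₁, mul_assoc])
    (by rw [Module.finrank_tensorProduct, Module.finrank_tensorProduct, h₂, mul_assoc])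
    f₁ f₂ (Algebra.TensorProduct.map j₁ (AlgHom.id F B₀))
    (Algebra.TensorProduct.map j₂ (AlgHom.id F B₀))
    (by rw [Module.finrank_matrix, Module.finrank_baseChange, Fintype.card_fin, ← hd, pow_two])
  exact ⟨n, m, hn, hm, ⟨(matrixBaseChange F K' B n).symm.trans E⟩⟩

end

section

open Equiv

/-- A permutation of order six in `S₅`. -/
def permSix : Perm (Fin 5) := c[0, 1, 2] * c[3, 4]

/-- The pointwise stabilizer of `{3, 4}` in `S₅`. -/
def permFixing : Subgroup (Perm (Fin 5)) where
  carrier := {s | s 3 = 3 ∧ s 4 = 4}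
  mul_mem' := by
    rintro a b ⟨h1, h2⟩ ⟨h3, h4⟩
    simp [*]
  one_mem' := by simp
  inv_mem' := by
    rintro a ⟨h1, h2⟩
    exact ⟨Perm.inv_eq_iff_eq.mpr h1.symm, Perm.inv_eq_iff_eq.mpr h2.symm⟩

theorem mem_permFixing {s : Perm (Fin 5)} : s ∈ permFixing ↔ s 3 = 3 ∧ s 4 = 4 := Iff.rfl

theorem orderOf_permSix : orderOf permSix = 6 := by
  rw [orderOf_eq_iff (by norm_num)]
  decide +kernel

theorem card_permFixing : Nat.card permFixing = 6 := by
  have h : ∀ s : Perm (Fin 5), s ∈ permFixing ↔ ∀ a, ¬ a < 3 → s a = a := by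
    intro s
    rw [mem_permFixing]
    refine ⟨fun hs a ha ↦ ?_, fun hs ↦ ⟨hs 3 (by decide), hs 4 (by decide)⟩⟩
    fin_cases a
    · exact absurd (by decide) ha
    · exact absurd (by decide) ha
    · exact absurd (by decide) ha
    · exact hs.1
    · exact hs.2
  rw [Nat.card_congr ((Equiv.subtypeEquivRight h).trans
    (Equiv.Perm.subtypeEquivSubtypePerm fun a : Fin 5 ↦ a < 3).symm),
    Nat.card_eq_fintype_card, Fintype.card_perm]
  rfl

open IntermediateField

section
variable {F : Type} [Field F] [NumberField F]

theorem nonempty_algHom_fixedField_of_conj (H J : Subgroup Gal(F/ℚ)) (g : Gal(F/ℚ))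
    (h : ∀ j ∈ J, g⁻¹ * j * g ∈ H) : Nonempty (fixedField H →ₐ[ℚ] fixedField J) := by
  refine ⟨(g.toAlgHom.comp (fixedField H).val).codRestrict (fixedField J).toSubalgebra
    fun x ↦ ?_⟩
  change g x ∈ fixedField J
  rw [mem_fixedField_iff]
  intro j hj
  have := (mem_fixedField_iff H (x : F)).mp x.2 _ (h j hj)
  have h2 := congrArg g this
  simpa using h2

theorem isEmpty_fixedField_ringEquiv [IsGalois ℚ F] (H J : Subgroup Gal(F/ℚ))
    (hH : ∀ a ∈ H, ∀ b ∈ H, a * b = b * a)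
    {s t : Gal(F/ℚ)} (hs : s ∈ J) (ht : t ∈ J) (hst : s * t ≠ t * s) :
    IsEmpty (fixedField H ≃+* fixedField J) := by
  refine ⟨fun φ ↦ hst ?_⟩
  let χ : fixedField H ≃ₐ[ℚ] fixedField J := AlgEquiv.ofRingEquiv (f := φ) (map_ratCast φ)
  let g : Gal(F/ℚ) := χ.liftNormal F
  have hg : ∀ j ∈ J, g⁻¹ * j * g ∈ H := by
    intro j hj
    rw [← fixingSubgroup_fixedField H, IntermediateField.mem_fixingSubgroup_iff]
    intro x hx
    have h1 : g x = χ ⟨x, hx⟩ := χ.liftNormal_commutes F ⟨x, hx⟩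
    have h2 : j (g x) = g x := by
      rw [h1]
      exact (mem_fixedField_iff J _).mp (χ ⟨x, hx⟩).2 j hj
    change g.symm (j (g x)) = x
    rw [h2, AlgEquiv.symm_apply_apply]
  have := hH _ (hg s hs) _ (hg t ht)
  have h3 : g⁻¹ * (s * t) * g = g⁻¹ * (t * s) * g := by
    simpa [mul_assoc] using this
  exact mul_left_cancel (mul_right_cancel h3)

/-- Two non-isomorphic subfields of an `S₅`-field that have common extensions of the same coprime
relative degrees. -/
theorem exists_intermediateFields_of_galois_perm [IsGalois ℚ F] (e : Gal(F/ℚ) ≃* Perm (Fin 5)) :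
    ∃ K K' L₁ L₂ : IntermediateField ℚ F, IsEmpty (K ≃+* K') ∧
      Nonempty (K →ₐ[ℚ] L₁) ∧ Nonempty (K →ₐ[ℚ] L₂) ∧
      Nonempty (K' →ₐ[ℚ] L₁) ∧ Nonempty (K' →ₐ[ℚ] L₂) ∧
      Module.finrank ℚ L₁ = 2 * Module.finrank ℚ K ∧
      Module.finrank ℚ L₂ = 3 * Module.finrank ℚ K ∧
      Module.finrank ℚ K' = Module.finrank ℚ K := by
  have key : ∀ H : Subgroup (Perm (Fin 5)),
      Module.finrank ℚ (fixedField (H.comap e.toMonoidHom)) * Nat.card H = 120 := by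
    intro H
    have h1 := Module.finrank_mul_finrank ℚ (fixedField (H.comap e.toMonoidHom)) F
    rw [finrank_fixedField_eq_card, ← IsGalois.card_aut_eq_finrank ℚ F] at h1
    have h2 : Nat.card (H.comap e.toMonoidHom) = Nat.card H :=
      Nat.card_congr (e.toEquiv.subtypeEquiv fun _ ↦ Iff.rfl)
    have h3 : Nat.card Gal(F/ℚ) = 120 := by
      rw [Nat.card_congr e.toEquiv, Nat.card_eq_fintype_card, Fintype.card_perm]; rfl
    rw [← h2, h1, h3]
  let H := Subgroup.zpowers permSix
  let P₁ := Subgroup.zpowers (permSix ^ 2)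
  let P₂ := Subgroup.zpowers (swap (0 : Fin 5) 1)
  have c : Nat.card H = 6 := by rw [Nat.card_zpowers, orderOf_permSix]
  have c₁ : Nat.card P₁ = 3 := by
    rw [Nat.card_zpowers, orderOf_pow, orderOf_permSix]; rfl
  have c₂ : Nat.card P₂ = 2 := by
    rw [Nat.card_zpowers]
    exact orderOf_eq_prime (by decide +kernel) (by decide +kernel)
  have k := key H
  have k' := key permFixing
  have k₁ := key P₁
  have k₂ := key P₂
  rw [c] at k
  rw [card_permFixing] at k'
  rw [c₁] at k₁
  rw [c₂] at k₂
  have hle : ∀ {A B : Subgroup (Perm (Fin 5))}, A ≤ B →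
      Nonempty (fixedField (B.comap e.toMonoidHom) →ₐ[ℚ] fixedField (A.comap e.toMonoidHom)) :=
    fun h ↦ nonempty_algHom_fixedField_of_conj _ _ 1 fun j hj ↦ by
      simpa using h (by simpa using hj)
  refine ⟨_, _, _, _, isEmpty_fixedField_ringEquiv (H.comap e.toMonoidHom)
    (permFixing.comap e.toMonoidHom) ?_ (s := e.symm (swap 0 1)) (t := e.symm (swap 1 2))
    ?_ ?_ ?_, hle (A := P₁) ?_, ?_, hle ?_, hle (A := P₂) ?_, ?_, ?_, ?_⟩
  · intro a ha b hb
    obtain ⟨m, hm⟩ := Subgroup.mem_zpowers_iff.mp (Subgroup.mem_comap.mp ha)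
    obtain ⟨n, hn⟩ := Subgroup.mem_zpowers_iff.mp (Subgroup.mem_comap.mp hb)
    change _ = e a at hm
    change _ = e b at hn
    apply e.injective
    rw [map_mul, map_mul, ← hm, ← hn, ← zpow_add, ← zpow_add, add_comm]
  · rw [Subgroup.mem_comap]
    change e (e.symm _) ∈ _
    rw [e.apply_symm_apply, mem_permFixing]
    decide +kernel
  · rw [Subgroup.mem_comap]
    change e (e.symm _) ∈ _
    rw [e.apply_symm_apply, mem_permFixing]
    decide +kernel
  · rw [← map_mul, ← map_mul]
    intro h
    have h := e.symm.injective h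
    revert h
    decide +kernel
  · exact Subgroup.zpowers_le.mpr (Subgroup.pow_mem _ (Subgroup.mem_zpowers _) _)
  · refine nonempty_algHom_fixedField_of_conj _ _ (e.symm (swap 0 3 * swap 1 4)) fun j hj ↦ ?_
    rw [Subgroup.mem_comap] at hj ⊢
    obtain ⟨n, hn⟩ := Subgroup.mem_zpowers_iff.mp hj
    change _ = e j at hn
    change e _ ∈ _
    rw [map_mul, map_mul, map_inv, e.apply_symm_apply, ← hn]
    have : (swap (0 : Fin 5) 3 * swap 1 4)⁻¹ * swap 0 1 ^ n * (swap 0 3 * swap 1 4) =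
        ((swap (0 : Fin 5) 3 * swap 1 4)⁻¹ * swap 0 1 * ((swap 0 3 * swap 1 4)⁻¹)⁻¹) ^ n := by
      rw [conj_zpow, inv_inv]
    rw [this]
    have h2 : (swap (0 : Fin 5) 3 * swap 1 4)⁻¹ * swap 0 1 * ((swap 0 3 * swap 1 4)⁻¹)⁻¹ =
        permSix ^ 3 := by decide +kernel
    rw [h2]
    exact Subgroup.zpow_mem _ (Subgroup.pow_mem _ (Subgroup.mem_zpowers _) _) _
  · rw [Subgroup.zpowers_le, mem_permFixing]
    decide +kernel
  · rw [Subgroup.zpowers_le, mem_permFixing]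
    decide +kernel
  · change Module.finrank ℚ (fixedField (P₁.comap e.toMonoidHom)) =
      2 * Module.finrank ℚ (fixedField (H.comap e.toMonoidHom))
    omega
  · change Module.finrank ℚ (fixedField (P₂.comap e.toMonoidHom)) =
      3 * Module.finrank ℚ (fixedField (H.comap e.toMonoidHom))
    omega
  · change Module.finrank ℚ (fixedField (permFixing.comap e.toMonoidHom)) =
      Module.finrank ℚ (fixedField (H.comap e.toMonoidHom))
    omega

end

end

section

open Polynomial

section
/-- The quintic `X ^ 5 - a * X + b`. -/
noncomputable def quintic (R : Type) [CommRing R] (a b : ℕ) : R[X] :=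
  X ^ 5 - C (a : R) * X + C (b : R)

variable {R S : Type} [CommRing R] [CommRing S] (f : R →+* S) (a b : ℕ)

@[simp] theorem quintic_map : (quintic R a b).map f = quintic S a b := by simp [quintic]

theorem quintic_eval (x : R) : (quintic R a b).eval x = x ^ 5 - a * x + b := by simp [quintic]

theorem quintic_degree [Nontrivial R] : (quintic R a b).degree = 5 := by
  unfold quintic; compute_degree!

theorem quintic_natDegree [Nontrivial R] : (quintic R a b).natDegree = 5 :=
  natDegree_eq_of_degree_eq_some (quintic_degree a b)

theorem quintic_monic : (quintic R a b).Monic := by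
  nontriviality R
  rw [Monic, leadingCoeff, quintic_natDegree]
  simp [quintic]

theorem quintic_ne_zero [Nontrivial R] : quintic R a b ≠ 0 := (quintic_monic a b).ne_zero

theorem quintic_irreducible_int (ha : 2 ∣ a) (hb : 2 ∣ b) (hb2 : ¬ 4 ∣ b) :
    Irreducible (quintic ℤ a b) := by
  have hprim := (quintic_monic (R := ℤ) a b).isPrimitive
  refine irreducible_of_eisenstein_criterion (P := Ideal.span {(2 : ℤ)})
    ((Ideal.span_singleton_prime (by norm_num)).mpr Int.prime_two) ?_ ?_ ?_ ?_ hprim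
  · rw [(quintic_monic a b).leadingCoeff, Ideal.mem_span_singleton]
    decide
  · intro n hn
    rw [quintic_degree] at hn
    have hn' : n < 5 := by exact_mod_cast hn
    rw [Ideal.mem_span_singleton]
    obtain ⟨a, rfl⟩ := ha
    obtain ⟨b, rfl⟩ := hb
    interval_cases n <;> simp [quintic, coeff_X, coeff_C, -map_natCast, -eq_intCast]
  · rw [quintic_degree]; norm_num
  · rw [Ideal.span_singleton_pow, Ideal.mem_span_singleton]
    simp only [quintic, coeff_add, coeff_sub, coeff_X_pow, coeff_C_mul, coeff_X_zero, coeff_C_zero]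
    norm_num
    exact_mod_cast hb2

theorem quintic_irreducible (ha : 2 ∣ a) (hb : 2 ∣ b) (hb2 : ¬ 4 ∣ b) :
    Irreducible (quintic ℚ a b) := by
  rw [← quintic_map (Int.castRingHom ℚ)]
  exact (quintic_monic a b).isPrimitive |> IsPrimitive.Int.irreducible_iff_irreducible_map_cast |>.mp
    (quintic_irreducible_int a b ha hb hb2)

theorem card_rootSet_quintic_le : Fintype.card ((quintic ℚ a b).rootSet ℝ) ≤ 3 := by
  have h1 := card_rootSet_le_derivative (quintic ℚ a b)
  have h2 := card_rootSet_le_derivative (derivative (quintic ℚ a b))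
  have h3 : derivative (derivative (quintic ℚ a b)) = C 20 * X ^ 3 := by
    simp only [quintic, derivative_add, derivative_sub, derivative_X_pow, derivative_C_mul,
      derivative_X, derivative_C]
    simp only [derivative_one]
    norm_num
    rw [← mul_assoc, ← C_mul]
    norm_num
  have h4 : Fintype.card ((derivative (derivative (quintic ℚ a b))).rootSet ℝ) ≤ 1 := by
    rw [Fintype.card_le_one_iff_subsingleton, Set.subsingleton_coe]
    intro x hx y hy
    rw [h3, mem_rootSet] at hx hy
    have hx := hx.2
    have hy := hy.2
    simp at hx hy
    rw [hx, hy]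
  omega

theorem two_le_card_rootSet_quintic (hab : b + 1 < a) (hb : b ≠ 0) :
    2 ≤ Fintype.card ((quintic ℚ a b).rootSet ℝ) := by
  have hc : Continuous fun x : ℝ ↦ x ^ 5 - a * x + b := by fun_prop
  have ha : (b : ℝ) + 1 < a := by exact_mod_cast hab
  have hb' : (1 : ℝ) ≤ b := by exact_mod_cast Nat.one_le_iff_ne_zero.mpr hb
  have mem : ∀ x : ℝ, x ^ 5 - a * x + b = 0 → x ∈ (quintic ℚ a b).rootSet ℝ := by
    intro x hx
    rw [mem_rootSet]
    refine ⟨quintic_ne_zero a b, ?_⟩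
    rw [← eval_map_algebraMap, quintic_map, quintic_eval, hx]
  obtain ⟨x, hx, hx0⟩ := intermediate_value_Ioo' (zero_le_one (α := ℝ)) hc.continuousOn
    (show (0 : ℝ) ∈ Set.Ioo _ _ from ⟨by norm_num; linarith, by norm_num; omega⟩)
  obtain ⟨y, hy, hy0⟩ := intermediate_value_Ioo (show (1 : ℝ) ≤ a by linarith) hc.continuousOn
    (show (0 : ℝ) ∈ Set.Ioo _ _ from ⟨by norm_num; linarith, by
      have : (a : ℝ) ^ 2 ≤ (a : ℝ) ^ 5 := pow_le_pow_right₀ (by linarith) (by norm_num)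
      nlinarith⟩)
  have hne : (⟨x, mem x hx0⟩ : (quintic ℚ a b).rootSet ℝ) ≠ ⟨y, mem y hy0⟩ := by
    intro h
    have : x = y := congrArg Subtype.val h
    linarith [hx.2, hy.1]
  exact Fintype.one_lt_card_iff.mpr ⟨_, _, hne⟩

theorem card_rootSet_quintic_complex (h : Irreducible (quintic ℚ a b)) :
    Fintype.card ((quintic ℚ a b).rootSet ℂ) = 5 := by
  rw [card_rootSet_eq_natDegree h.separable (IsAlgClosed.splits _), quintic_natDegree]

/-- The Galois group of a suitable quintic is the full symmetric group. -/
theorem nonempty_gal_quintic_mulEquiv (h : Irreducible (quintic ℚ a b)) (hab : b + 1 < a)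
    (hb : b ≠ 0) : Nonempty ((quintic ℚ a b).Gal ≃* Equiv.Perm (Fin 5)) := by
  have h5 := card_rootSet_quintic_complex a b h
  have h3 := card_rootSet_quintic_le a b
  have h2 := two_le_card_rootSet_quintic a b hab hb
  have hb := Gal.galActionHom_bijective_of_prime_degree' h
    (by rw [quintic_natDegree]; norm_num) (by omega) (by omega)
  exact ⟨(MulEquiv.ofBijective _ hb).trans
    (Fintype.equivFinOfCardEq h5).permCongrHom⟩
end

end

section

open Polynomial WithZero

theorem quintic_of_charP (p : ℕ) (k : Type) [Field k] [CharP k p] :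
    quintic k (3 * p + 1) (2 * p) = X ^ 5 - X := by simp [quintic]

section
variable (p : ℕ) [Fact p.Prime]

/-- The ring of Witt vectors of an algebraic closure of `𝔽_p`. -/
abbrev WittBar : Type := WittVector p (AlgebraicClosure (ZMod p))

instance WittBar.charZero : CharZero (WittBar p) := by
  refine charZero_of_inj_zero fun n hn ↦ ?_
  by_contra h0
  obtain ⟨e, m, hm, rfl⟩ := Nat.exists_eq_pow_mul_and_not_dvd h0 p (Fact.out : p.Prime).ne_one
  rw [Nat.cast_mul, Nat.cast_pow, mul_eq_zero] at hn
  rcases hn with hn | hn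
  · exact pow_ne_zero _ (WittVector.irreducible p).ne_zero hn
  · have h := congrArg (WittVector.constantCoeff (p := p)) hn
    rw [map_natCast, map_zero, CharP.cast_eq_zero_iff _ p] at h
    exact hm h

theorem WittBar.valuation_unit {K : Type} [Field K] [Algebra (WittBar p) K]
    [IsFractionRing (WittBar p) K] {u : WittBar p} (hu : IsUnit u) :
    (IsDiscreteValuationRing.maximalIdeal (WittBar p)).valuation K (algebraMap _ K u) = 1 := by
  rw [IsDedekindDomain.HeightOneSpectrum.valuation_eq_one_iff_notMem]
  exact fun h ↦ (IsLocalRing.mem_maximalIdeal u).mp h hu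

theorem WittBar.valuation_p {K : Type} [Field K] [Algebra (WittBar p) K]
    [IsFractionRing (WittBar p) K] :
    (IsDiscreteValuationRing.maximalIdeal (WittBar p)).valuation K (p : K) = exp (-1) := by
  rw [← map_natCast (algebraMap (WittBar p) K),
    IsDedekindDomain.HeightOneSpectrum.valuation_of_algebraMap]
  exact IsDedekindDomain.HeightOneSpectrum.intValuation_singleton _
    (WittVector.irreducible p).ne_zero (WittVector.irreducible p).maximalIdeal_eq

/-- The Frobenius automorphism of the fraction field of `WittBar p`. -/
noncomputable def WittBar.frob : FractionRing (WittBar p) ≃+* FractionRing (WittBar p) :=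
  IsFractionRing.ringEquivOfRingEquiv (WittVector.frobeniusEquiv p (AlgebraicClosure (ZMod p)))

theorem WittBar.frob_algebraMap (x : WittBar p) :
    WittBar.frob p (algebraMap _ _ x) = algebraMap _ _ (WittVector.frobenius x) := by
  simp [WittBar.frob]

theorem WittBar.valuation_frob (x : FractionRing (WittBar p)) :
    (IsDiscreteValuationRing.maximalIdeal (WittBar p)).valuation (FractionRing (WittBar p))
      (WittBar.frob p x) =
    (IsDiscreteValuationRing.maximalIdeal (WittBar p)).valuation (FractionRing (WittBar p)) x := by
  have key : ∀ a : WittBar p,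
      (IsDiscreteValuationRing.maximalIdeal (WittBar p)).valuation (FractionRing (WittBar p))
        (WittBar.frob p (algebraMap _ _ a)) =
      (IsDiscreteValuationRing.maximalIdeal (WittBar p)).valuation (FractionRing (WittBar p))
        (algebraMap _ _ a) := by
    intro a
    by_cases ha : a = 0
    · simp [ha]
    obtain ⟨m, b, rfl⟩ := WittVector.exists_eq_pow_p_mul' a ha
    rw [map_mul, map_mul, map_mul, map_mul]
    congr 1
    · simp
    · rw [WittBar.frob_algebraMap, WittBar.valuation_unit p b.isUnit,
        WittBar.valuation_unit p (b.isUnit.map WittVector.frobenius)]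
  obtain ⟨a, b, hb, rfl⟩ := IsFractionRing.div_surjective (A := WittBar p) x
  rw [map_div₀, map_div₀, map_div₀, key, key]

theorem WittBar.frob_teichmuller (z : AlgebraicClosure (ZMod p)) :
    WittBar.frob p (algebraMap _ _ (WittVector.teichmuller p z)) =
      algebraMap _ _ (WittVector.teichmuller p z) ^ p := by
  rw [WittBar.frob_algebraMap, WittVector.frobenius_eq_map_frobenius, WittVector.map_teichmuller,
    frobenius_def, map_pow, map_pow]

theorem WittBar.exists_primitiveRoot {q : ℕ} (hq : q.Prime) (hqp : q ≠ p) :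
    ∃ ζ : FractionRing (WittBar p), IsPrimitiveRoot ζ q ∧ WittBar.frob p ζ = ζ ^ p := by
  have : NeZero (q : AlgebraicClosure (ZMod p)) := ⟨by
    rw [Ne, CharP.cast_eq_zero_iff _ p, Nat.prime_dvd_prime_iff_eq Fact.out hq]
    exact hqp.symm⟩
  obtain ⟨z, hz⟩ := HasEnoughRootsOfUnity.exists_primitiveRoot (AlgebraicClosure (ZMod p)) q
  refine ⟨_, (hz.map_of_injective (f := WittVector.teichmuller p) ?_).map_of_injective
    (IsFractionRing.injective (WittBar p) _), WittBar.frob_teichmuller p z⟩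
  intro a b h
  rw [← WittVector.teichmuller_coeff_zero p a, h, WittVector.teichmuller_coeff_zero]

theorem quintic_separable (k : Type) [Field k] [CharP k p] (hp : p ≠ 2) :
    (quintic k (3 * p + 1) (2 * p)).Separable := by
  have h4 : (4 : k) ≠ 0 := by
    have : ((4 : ℕ) : k) ≠ 0 := by
      rw [Ne, CharP.cast_eq_zero_iff _ p]
      intro h
      exact hp ((Nat.prime_dvd_prime_iff_eq Fact.out Nat.prime_two).mp
        ((Fact.out : p.Prime).dvd_of_dvd_pow (show p ∣ 2 ^ 2 from h)))
    exact_mod_cast this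
  have h41 : (C (4⁻¹ : k)) * 4 = 1 := by
    rw [← C_ofNat, ← C_mul, inv_mul_cancel₀ h4, C_1]
  rw [quintic_of_charP p k]
  refine ⟨-(C (4⁻¹ : k) * 25 * X ^ 3), C (4⁻¹ : k) * 5 * X ^ 4 - 1, ?_⟩
  simp only [derivative_sub, derivative_X_pow, derivative_X]
  rw [show (C (((5 : ℕ) : k)) : k[X]) = 5 from map_natCast C 5]
  norm_num
  linear_combination (5 * X ^ 4 : k[X]) * h41

theorem WittBar.splits_quintic (hp : p % 4 = 1) :
    (quintic (FractionRing (WittBar p)) (3 * p + 1) (2 * p)).Splits ∧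
    ∀ x : FractionRing (WittBar p),
      (quintic (FractionRing (WittBar p)) (3 * p + 1) (2 * p)).eval x = 0 →
      WittBar.frob p x = x := by
  classical
  set k := AlgebraicClosure (ZMod p)
  set Ω := FractionRing (WittBar p)
  set fk := quintic k (3 * p + 1) (2 * p) with hfk
  have hsep : fk.Separable := quintic_separable p k (by rintro rfl; norm_num at hp)
  have hcard : fk.roots.toFinset.card = 5 := by
    rw [Multiset.toFinset_card_of_nodup (nodup_roots hsep),
      ← (IsAlgClosed.splits fk).natDegree_eq_card_roots, quintic_natDegree]
  have hens : ∀ a : k, fk.eval a = 0 → ∃ α : WittBar p,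
      (quintic (WittBar p) (3 * p + 1) (2 * p)).eval α = 0 ∧ α.coeff 0 = a := by
    intro a ha
    have hmap : (quintic (WittBar p) (3 * p + 1) (2 * p)).map WittVector.constantCoeff = fk :=
      quintic_map _ _ _
    have hH : HenselianRing (WittBar p) (Ideal.span {(p : WittBar p)}) := inferInstance
    obtain ⟨α, h1, h2⟩ := hH.is_henselian _ (quintic_monic (R := WittBar p) (3 * p + 1) (2 * p))
      (WittVector.teichmuller p a) (by
        rw [WittVector.mem_span_p_iff_coeff_zero_eq_zero]
        change WittVector.constantCoeff _ = 0
        rw [← eval_map_apply, hmap]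
        change fk.eval ((WittVector.teichmuller p a).coeff 0) = 0
        rw [WittVector.teichmuller_coeff_zero, ha]) (by
        apply IsUnit.map
        apply WittVector.isUnit_of_coeff_zero_ne_zero
        change WittVector.constantCoeff _ ≠ 0
        rw [← eval_map_apply, ← derivative_map, hmap]
        change fk.derivative.eval ((WittVector.teichmuller p a).coeff 0) ≠ 0
        rw [WittVector.teichmuller_coeff_zero]
        exact hsep.eval₂_derivative_ne_zero (RingHom.id k) ha)
    refine ⟨α, h1, ?_⟩
    rw [← WittVector.ker_constantCoeff, RingHom.mem_ker, map_sub, sub_eq_zero] at h2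
    rw [← WittVector.teichmuller_coeff_zero p a]
    exact h2
  choose! α hα hα0 using hens
  set fΩ := quintic Ω (3 * p + 1) (2 * p) with hfΩ
  have hroot : ∀ a, fk.eval a = 0 → fΩ.eval (algebraMap (WittBar p) Ω (α a)) = 0 := by
    intro a ha
    rw [hfΩ, ← quintic_map (algebraMap (WittBar p) Ω), eval_map_apply, hα a ha, map_zero]
  have hne : fΩ ≠ 0 := quintic_ne_zero _ _
  have hsub : fk.roots.toFinset.image (fun a ↦ algebraMap (WittBar p) Ω (α a)) ⊆
      fΩ.roots.toFinset := by
    intro x hx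
    obtain ⟨a, ha, rfl⟩ := Finset.mem_image.mp hx
    rw [Multiset.mem_toFinset, mem_roots'] at ha
    rw [Multiset.mem_toFinset, mem_roots']
    exact ⟨hne, hroot a ha.2⟩
  have hinj : Set.InjOn (fun a ↦ algebraMap (WittBar p) Ω (α a)) (fk.roots.toFinset : Set k) := by
    intro a ha b hb hab
    rw [Finset.mem_coe, Multiset.mem_toFinset, mem_roots'] at ha hb
    have := IsFractionRing.injective (WittBar p) Ω hab
    rw [← hα0 a ha.2, this, hα0 b hb.2]
  have hc : (fk.roots.toFinset.image (fun a ↦ algebraMap (WittBar p) Ω (α a))).card = 5 := by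
    rw [Finset.card_image_of_injOn hinj, hcard]
  have hle : fΩ.roots.toFinset.card ≤ 5 := by
    refine (Multiset.toFinset_card_le _).trans ((card_roots' _).trans ?_)
    rw [quintic_natDegree]
  have heq := Finset.eq_of_subset_of_card_le hsub (by rw [hc]; exact hle)
  refine ⟨?_, ?_⟩
  · rw [splits_iff_card_roots]
    refine le_antisymm (card_roots' _) ?_
    rw [quintic_natDegree, ← hc, heq]
    exact Multiset.toFinset_card_le _
  · have hform : ∀ x : Ω, fΩ.eval x = 0 → ∃ a, fk.eval a = 0 ∧ algebraMap (WittBar p) Ω (α a) = x := by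
      intro x hx
      have : x ∈ fΩ.roots.toFinset := by
        rw [Multiset.mem_toFinset, mem_roots']
        exact ⟨hne, hx⟩
      rw [← heq, Finset.mem_image] at this
      obtain ⟨a, ha, h⟩ := this
      rw [Multiset.mem_toFinset, mem_roots'] at ha
      exact ⟨a, ha.2, h⟩
    intro x hx
    obtain ⟨a, ha, rfl⟩ := hform x hx
    obtain ⟨b, hb, h⟩ := hform (WittBar.frob p (algebraMap (WittBar p) Ω (α a))) (by
      rw [hfΩ, ← quintic_map (WittBar.frob p : Ω →+* Ω)]
      change eval ((WittBar.frob p : Ω →+* Ω) _) _ = 0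
      rw [eval_map_apply, hx, map_zero])
    rw [← h]
    rw [WittBar.frob_algebraMap] at h
    have h2 := congrArg (WittVector.coeff · 0) (IsFractionRing.injective (WittBar p) Ω h)
    simp only [WittVector.coeff_frobenius_charP] at h2
    rw [hα0 a ha, hα0 b hb] at h2
    have ha5 : a ^ 5 = a := by
      rw [hfk, quintic_of_charP p k, eval_sub, eval_pow, eval_X] at ha
      exact sub_eq_zero.mp ha
    obtain ⟨t, rfl⟩ : ∃ t, p = 4 * t + 1 := ⟨p / 4, by omega⟩
    have hap : ∀ t, a ^ (4 * t + 1) = a := by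
      intro t
      induction t with
      | zero => simp
      | succ t ih =>
        calc a ^ (4 * (t + 1) + 1) = a ^ (4 * t + 1) * a ^ 4 := by ring
          _ = a ^ 5 := by rw [ih]; ring
          _ = a := ha5
    rw [h2, hap]

end

end

section

open TensorProduct WithZero

/-- A field `Ω` with an automorphism of finite order and a discrete valuation, together with a
cyclic extension `E` of `ℚ` embedded in it. -/
structure FrobeniusData (p d : ℕ) (Ω E : Type) [Field Ω] [CharZero Ω] [Field E] [CharZero E] where
  pos : 0 < d
  φ : Ω →+* Ω
  iterate_φ : ∀ x, φ^[d] x = x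
  v : Valuation Ω ℤᵐ⁰
  v_φ : ∀ x, v (φ x) = v x
  v_p : v (p : Ω) = exp (-1)
  ι : E →ₐ[ℚ] Ω
  σ : E → E
  φ_ι : ∀ x, φ (ι x) = ι (σ x)
  finrank_eq : Module.finrank ℚ E = d
  faithful : ∀ i, 0 < i → i < d → ∃ x, φ^[i] (ι x) ≠ ι x

namespace FrobeniusData

variable {p d : ℕ} {Ω E : Type} [Field Ω] [CharZero Ω] [Field E] [CharZero E]
  (D : FrobeniusData p d Ω E)

/-- The space of functions `f : ℤ → Ω` with `f (n - d) = p * f n`. -/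
def space (_ : FrobeniusData p d Ω E) : Submodule Ω (ℤ → Ω) where
  carrier := {f | ∀ n, f (n - d) = p * f n}
  add_mem' {f g} (hf : ∀ n, _) (hg : ∀ n, _) n := by
    simp only [Pi.add_apply, hf, hg, mul_add]
  zero_mem' n := by simp
  smul_mem' c f (hf : ∀ n, _) n := by
    simp only [Pi.smul_apply, hf, smul_eq_mul]
    ring

/-- The type of functions `f : ℤ → Ω` with `f (n - d) = p * f n`. -/
def Space : Type := D.space

noncomputable instance : AddCommGroup D.Space := inferInstanceAs (AddCommGroup D.space)

noncomputable instance : Module Ω D.Space := inferInstanceAs (Module Ω D.space)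

noncomputable instance : Module ℚ D.Space := inferInstanceAs (Module ℚ D.space)

instance : IsScalarTower ℚ Ω D.Space := inferInstanceAs (IsScalarTower ℚ Ω D.space)

variable {D} in
@[ext] theorem Space.ext {f g : D.Space} (h : ∀ n, f.1 n = g.1 n) : f = g :=
  Subtype.ext (funext h)

theorem Space.sum_apply {ι : Type} (s : Finset ι) (f : ι → D.Space) (n : ℤ) :
    (∑ i ∈ s, f i).1 n = ∑ i ∈ s, (f i).1 n :=
  map_sum ((Pi.evalAddMonoidHom (fun _ ↦ Ω) n).comp D.space.subtype.toAddMonoidHom) f s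

theorem space_apply (f : D.Space) (n : ℤ) : f.1 (n - d) = p * f.1 n := f.2 n

/-- The semilinear shift operator. -/
def shift : Module.End ℚ D.Space where
  toFun f := ⟨fun n ↦ D.φ (f.1 (n - 1)), fun n ↦ by
    change D.φ (f.1 (n - d - 1)) = p * D.φ (f.1 (n - 1))
    rw [sub_right_comm, D.space_apply, map_mul, map_natCast]⟩
  map_add' f g := by
    ext n
    exact map_add D.φ (f.1 (n - 1)) (g.1 (n - 1))
  map_smul' c f := by
    ext n
    change D.φ (c • f.1 (n - 1)) = c • D.φ (f.1 (n - 1))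
    exact map_rat_smul _ _ _

/-- Multiplication operators. -/
noncomputable def mulOp : Ω →ₐ[ℚ] Module.End ℚ D.Space := Algebra.lsmul ℚ ℚ D.Space

theorem mulOp_apply (x : Ω) (f : D.Space) (n : ℤ) : (D.mulOp x f).1 n = x * f.1 n := rfl

theorem shift_pow_apply (i : ℕ) (f : D.Space) (n : ℤ) :
    ((D.shift ^ i) f).1 n = D.φ^[i] (f.1 (n - i)) := by
  induction i generalizing n with
  | zero => simp
  | succ i ih =>
    rw [pow_succ', Module.End.mul_apply, Function.iterate_succ_apply']
    change D.φ (((D.shift ^ i) f).1 (n - 1)) = _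
    rw [ih]
    rw [show n - 1 - (i : ℤ) = n - ((i + 1 : ℕ) : ℤ) by push_cast; ring]

theorem shift_pow_mul_mulOp (i : ℕ) (x : Ω) :
    D.shift ^ i * D.mulOp x = D.mulOp (D.φ^[i] x) * D.shift ^ i := by
  refine LinearMap.ext fun f ↦ Space.ext fun n ↦ ?_
  rw [Module.End.mul_apply, Module.End.mul_apply, shift_pow_apply, mulOp_apply, mulOp_apply,
    shift_pow_apply]
  simp

theorem shift_pow_eq : D.shift ^ d = D.mulOp p := by
  refine LinearMap.ext fun f ↦ Space.ext fun n ↦ ?_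
  rw [shift_pow_apply, mulOp_apply, D.iterate_φ, space_apply]

theorem φ_mulOp_commute {x : Ω} (hx : D.φ x = x) (i : ℕ) :
    Commute (D.mulOp x) (D.shift ^ i) := by
  have h : D.φ^[i] x = x := Function.iterate_fixed hx i
  have := D.shift_pow_mul_mulOp i x
  rw [h] at this
  exact this.symm

/-- The operator `∑ z i * u ^ i`, where `u` is the shift. -/
noncomputable def op (z : Fin d → Ω) : Module.End ℚ D.Space :=
  ∑ i, D.mulOp (z i) * D.shift ^ (i : ℕ)

theorem op_apply (z : Fin d → Ω) (f : D.Space) (n : ℤ) :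
    (D.op z f).1 n = ∑ i : Fin d, z i * D.φ^[i] (f.1 (n - (i : ℕ))) := by
  rw [op, LinearMap.sum_apply, Space.sum_apply]
  refine Finset.sum_congr rfl fun i _ ↦ ?_
  rw [Module.End.mul_apply, mulOp_apply, shift_pow_apply]

include D in
theorem p_ne_zero : (p : Ω) ≠ 0 := by
  intro h
  have := D.v_p
  rw [h, map_zero] at this
  exact exp_ne_zero this.symm

theorem v_iterate (i : ℕ) (x : Ω) : D.v (D.φ^[i] x) = D.v x := by
  induction i generalizing x with
  | zero => rfl
  | succ i ih => rw [Function.iterate_succ_apply, ih, D.v_φ]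

theorem v_apply_sub (f : D.Space) (n : ℤ) : D.v (f.1 (n - d)) = exp (-1) * D.v (f.1 n) := by
  rw [D.space_apply, map_mul, D.v_p]

/-- The weight of a function at an integer; it is periodic of period `d`. -/
noncomputable def weight (f : D.Space) (n : ℤ) : ℤᵐ⁰ := D.v (f.1 n) ^ d * exp (-n)

theorem weight_sub (f : D.Space) (n : ℤ) : D.weight f (n - d) = D.weight f n := by
  rw [weight, weight, v_apply_sub, mul_pow, ← exp_nsmul, mul_comm (exp _), mul_assoc, ← exp_add]
  congr 2
  simp only [nsmul_eq_mul]
  ring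

theorem weight_emod (f : D.Space) (n : ℤ) : D.weight f (n % d) = D.weight f n := by
  have key : ∀ (k : ℕ) (n : ℤ), D.weight f (n - d * k) = D.weight f n := by
    intro k
    induction k with
    | zero => intro n; simp
    | succ k ih =>
      intro n
      rw [← ih n, ← D.weight_sub f (n - d * k)]
      congr 1
      push_cast
      ring
  have h := Int.emod_add_mul_ediv n d
  rcases Int.eq_nat_or_neg (n / d) with ⟨k, hk | hk⟩
  · rw [← key k n, ← hk]
    congr 1
    linarith
  · rw [← key k (n % d)]
    congr 1
    rw [hk] at h
    linarith

theorem exists_weight_max {f : D.Space} (hf : f ≠ 0) :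
    ∃ n, D.weight f n ≠ 0 ∧ ∀ m, D.weight f m ≤ D.weight f n := by
  have : Nonempty (Fin d) := ⟨⟨0, D.pos⟩⟩
  have hd : (0 : ℤ) < d := by exact_mod_cast D.pos
  obtain ⟨i, hi⟩ := Finite.exists_max fun i : Fin d ↦ D.weight f (i : ℕ)
  have hmax : ∀ m, D.weight f m ≤ D.weight f (i : ℕ) := by
    intro m
    rw [← D.weight_emod f m]
    have h0 := Int.emod_nonneg m hd.ne'
    have h1 := Int.emod_lt_of_pos m hd
    have := hi ⟨(m % d).toNat, by omega⟩
    simpa [Int.toNat_of_nonneg h0] using this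
  refine ⟨_, fun h0 ↦ hf ?_, hmax⟩
  ext n
  have := hmax n
  rw [h0, le_zero_iff, weight, mul_eq_zero, or_iff_left exp_ne_zero] at this
  exact D.v.zero_iff.mp (eq_zero_of_pow_eq_zero this)

/-- A nonzero operator `∑ z i * u ^ i` is injective. -/
theorem op_apply_ne_zero {z : Fin d → Ω} (hz : z ≠ 0) {f : D.Space} (hf : f ≠ 0) :
    D.op z f ≠ 0 := by
  classical
  have : Nonempty (Fin d) := ⟨⟨0, D.pos⟩⟩
  obtain ⟨n, hn0, hn⟩ := D.exists_weight_max hf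
  obtain ⟨k, hk⟩ := Finite.exists_max fun i : Fin d ↦ D.v (z i) ^ d * exp (-(i : ℤ))
  have hk0 : D.v (z k) ^ d * exp (-(k : ℤ)) ≠ 0 := by
    intro h0
    refine hz (funext fun i ↦ ?_)
    have := hk i
    rw [h0, le_zero_iff, mul_eq_zero, or_iff_left exp_ne_zero] at this
    simpa using eq_zero_of_pow_eq_zero this
  have hlt : ∀ i : Fin d, i ≠ k →
      D.v (z i) ^ d * exp (-(i : ℤ)) < D.v (z k) ^ d * exp (-(k : ℤ)) := by
    intro i hik
    refine lt_of_le_of_ne (hk i) fun h ↦ hik ?_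
    have hzk : D.v (z k) ≠ 0 := fun h0 ↦ hk0 (by rw [h0, zero_pow D.pos.ne', zero_mul])
    have hzi : D.v (z i) ≠ 0 := fun h0 ↦ hk0 (by rw [← h, h0, zero_pow D.pos.ne', zero_mul])
    rw [← exp_log hzk, ← exp_log hzi, ← exp_nsmul, ← exp_nsmul, ← exp_add, ← exp_add,
      exp_inj] at h
    simp only [nsmul_eq_mul] at h
    have hi := i.2
    have hk := k.2
    have : ((i : ℤ) - k) = d * (log (D.v (z i)) - log (D.v (z k))) := by linarith
    have hdvd : (d : ℤ) ∣ (i : ℤ) - k := ⟨_, this⟩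
    have := Int.eq_zero_of_abs_lt_dvd hdvd (by rw [abs_lt]; constructor <;> omega)
    exact Fin.ext (by omega)
  have hterm : ∀ i : Fin d, D.v (z i * D.φ^[i] (f.1 (n + k - (i : ℕ)))) ^ d * exp (-(n + k)) =
      D.v (z i) ^ d * exp (-(i : ℤ)) * D.weight f (n + k - (i : ℕ)) := by
    intro i
    rw [map_mul, v_iterate, mul_pow, weight, mul_mul_mul_comm, ← exp_add]
    congr 2
    ring
  have hkey : D.v ((D.op z f).1 (n + k)) = D.v (z k * D.φ^[k] (f.1 (n + k - (k : ℕ)))) := by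
    rw [op_apply]
    refine Valuation.map_sum_eq_of_lt _ (Finset.mem_univ k) fun i hi ↦ ?_
    have hik : i ≠ k := by simpa using hi
    refine lt_of_pow_lt_pow_left₀ d zero_le ?_
    refine lt_of_mul_lt_mul_right ?_ (zero_le (a := exp (-(n + k : ℤ))))
    rw [hterm, hterm, add_sub_cancel_right]
    calc _ ≤ D.v (z i) ^ d * exp (-(i : ℤ)) * D.weight f n := mul_le_mul_right (hn _) _
      _ < _ := mul_lt_mul_of_pos_right (hlt i hik) (zero_lt_iff.mpr hn0)
  intro h0
  have h1 := hterm k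
  rw [← hkey, h0, add_sub_cancel_right] at h1
  have : (0 : D.Space).1 (n + k) = 0 := rfl
  rw [this, map_zero, zero_pow D.pos.ne', zero_mul] at h1
  exact mul_ne_zero hk0 hn0 h1.symm

end FrobeniusData

end

section

open TensorProduct

theorem isSimpleRing_of_isUnit {R : Type} [Ring R] [Nontrivial R]
    (h : ∀ x : R, x ≠ 0 → IsUnit x) : IsSimpleRing R := by
  classical
  let := DivisionRing.ofIsUnitOrEqZero fun x : R ↦ (eq_or_ne x 0).symm.imp_left (h x)
  exact DivisionRing.isSimpleRing R

namespace FrobeniusData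

variable {p d : ℕ} {Ω E : Type} [Field Ω] [CharZero Ω] [Field E] [CharZero E]
  (D : FrobeniusData p d Ω E)

theorem exists_space_ne_zero : ∃ f : D.Space, f ≠ 0 := by
  classical
  have hd : (d : ℤ) ≠ 0 := by exact_mod_cast D.pos.ne'
  refine ⟨⟨fun n ↦ if (d : ℤ) ∣ n then (p : Ω) ^ (-(n / d)) else 0, fun n ↦ ?_⟩, fun h ↦ ?_⟩
  · have h1 : (d : ℤ) ∣ n - d ↔ (d : ℤ) ∣ n := dvd_sub_self_right
    have h2 : -((n - d) / d) = -(n / d) + 1 := by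
      rw [Int.sub_ediv_of_dvd _ (dvd_refl _), Int.ediv_self hd]
      ring
    simp only [h1, h2]
    split_ifs
    · rw [zpow_add₀ D.p_ne_zero, zpow_one, mul_comm]
    · simp
  · have h0 := congrFun (congrArg Subtype.val h) 0
    simp only [dvd_zero, if_true, Int.zero_ediv, neg_zero, zpow_zero] at h0
    exact one_ne_zero h0

theorem op_eq_zero {z : Fin d → Ω} (h : D.op z = 0) : z = 0 := by
  by_contra hz
  obtain ⟨f, hf⟩ := D.exists_space_ne_zero
  exact D.op_apply_ne_zero hz hf (by rw [h]; rfl)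

theorem op_sub (z w : Fin d → Ω) : D.op (z - w) = D.op z - D.op w := by
  simp [op, sub_mul, Finset.sum_sub_distrib]

theorem op_injective : Function.Injective D.op := by
  intro z w h
  rw [← sub_eq_zero] at h ⊢
  rw [← op_sub] at h
  exact D.op_eq_zero h

theorem iterate_φ_ι (i : ℕ) (x : E) : D.φ^[i] (D.ι x) = D.ι (D.σ^[i] x) := by
  induction i generalizing x with
  | zero => rfl
  | succ i ih => rw [Function.iterate_succ_apply, D.φ_ι, ih, Function.iterate_succ_apply]

/-- The operators with coefficients in `E`, as a linear map. -/
noncomputable def coeffOp : (Fin d → E) →ₗ[ℚ] Module.End ℚ D.Space where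
  toFun e := D.op fun i ↦ D.ι (e i)
  map_add' e e' := by simp [op, add_mul, Finset.sum_add_distrib]
  map_smul' c e := by simp [op, Finset.smul_sum, map_rat_smul]

theorem coeffOp_injective : Function.Injective D.coeffOp := by
  intro e e' h
  have := D.op_injective h
  exact funext fun i ↦ D.ι.injective (congrFun this i)

theorem mulOp_mul_shift_mem (x : E) (n : ℕ) :
    D.mulOp (D.ι x) * D.shift ^ n ∈ LinearMap.range D.coeffOp := by
  classical
  refine ⟨Pi.single ⟨n % d, Nat.mod_lt _ D.pos⟩ (x * (p : E) ^ (n / d)), ?_⟩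
  change D.op _ = _
  rw [op, Finset.sum_eq_single ⟨n % d, Nat.mod_lt _ D.pos⟩]
  · conv_rhs => rw [← Nat.div_add_mod n d, pow_add, pow_mul, shift_pow_eq, ← map_pow, ← mul_assoc,
      ← map_mul]
    simp
  · intro i _ hi
    rw [Pi.single_eq_of_ne hi]
    simp
  · simp

theorem coeffOp_mul_mem (e e' : Fin d → E) :
    D.coeffOp e * D.coeffOp e' ∈ LinearMap.range D.coeffOp := by
  change D.op _ * D.op _ ∈ _
  rw [op, op, Finset.sum_mul_sum]
  refine Submodule.sum_mem _ fun i _ ↦ Submodule.sum_mem _ fun j _ ↦ ?_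
  have : D.mulOp (D.ι (e i)) * D.shift ^ (i : ℕ) * (D.mulOp (D.ι (e' j)) * D.shift ^ (j : ℕ)) =
      D.mulOp (D.ι (e i * D.σ^[i] (e' j))) * D.shift ^ ((i : ℕ) + j) := by
    rw [mul_assoc, ← mul_assoc (D.shift ^ (i : ℕ)), shift_pow_mul_mulOp, iterate_φ_ι, map_mul,
      map_mul, pow_add]
    simp only [mul_assoc]
  rw [this]
  exact D.mulOp_mul_shift_mem _ _

/-- The cyclic algebra `⨁ E u ^ i` over `ℚ`. -/
noncomputable def cyclicAlgebra : Subalgebra ℚ (Module.End ℚ D.Space) :=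
  (LinearMap.range D.coeffOp).toSubalgebra
    (by simpa using D.mulOp_mul_shift_mem 1 0)
    (by rintro _ _ ⟨e, rfl⟩ ⟨e', rfl⟩; exact D.coeffOp_mul_mem e e')

theorem mulOp_mem (x : E) : D.mulOp (D.ι x) ∈ D.cyclicAlgebra := by
  have := D.mulOp_mul_shift_mem x 0
  rwa [pow_zero, mul_one] at this

theorem shift_mem : D.shift ∈ D.cyclicAlgebra := by
  have := D.mulOp_mul_shift_mem 1 1
  rwa [map_one, map_one, one_mul, pow_one] at this

/-- The linear parametrization of the cyclic algebra. -/
noncomputable def coeffEquiv : (Fin d → E) ≃ₗ[ℚ] D.cyclicAlgebra :=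
  LinearEquiv.ofInjective D.coeffOp D.coeffOp_injective

theorem coe_coeffEquiv (e : Fin d → E) :
    (D.coeffEquiv e : Module.End ℚ D.Space) = D.op fun i ↦ D.ι (e i) := rfl

include D in
theorem finiteDimensional_E : FiniteDimensional ℚ E :=
  Module.finite_of_finrank_pos (by rw [D.finrank_eq]; exact D.pos)

/-- A basis of `E`. -/
noncomputable def basisE : Module.Basis (Fin d) ℚ E :=
  have := D.finiteDimensional_E
  Module.finBasisOfFinrankEq ℚ E D.finrank_eq

/-- A basis of the cyclic algebra. -/
noncomputable def basis : Module.Basis (Σ _ : Fin d, Fin d) ℚ D.cyclicAlgebra :=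
  (Pi.basis fun _ ↦ D.basisE).map D.coeffEquiv

theorem coe_basis (i j : Fin d) : (D.basis ⟨i, j⟩ : Module.End ℚ D.Space) =
    D.mulOp (D.ι (D.basisE j)) * D.shift ^ (i : ℕ) := by
  classical
  rw [basis, Module.Basis.map_apply, coe_coeffEquiv, op, Finset.sum_eq_single i]
  · simp [Pi.basis_apply]
  · intro k _ hk
    simp [Pi.basis_apply, hk]
  · simp

theorem finrank_cyclicAlgebra : Module.finrank ℚ D.cyclicAlgebra = d ^ 2 := by
  rw [Module.finrank_eq_card_basis D.basis]
  simp [sq]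

theorem finiteDimensional_cyclicAlgebra : FiniteDimensional ℚ D.cyclicAlgebra :=
  Module.Finite.of_basis D.basis

theorem iterate_φ_ι_injective :
    Function.Injective fun k : Fin d ↦ ((D.φ ^ (k : ℕ)).comp (D.ι : E →+* Ω) : E →* Ω) := by
  have key : ∀ k l : Fin d, k < l → ¬ ∀ x, D.φ^[k] (D.ι x) = D.φ^[l] (D.ι x) := by
    intro k l hkl h
    obtain ⟨x, hx⟩ := D.faithful (l - k) (by omega) (by omega)
    refine hx ?_
    have := h x
    rw [show (l : ℕ) = k + (l - k) by omega, Function.iterate_add_apply] at this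
    exact (D.φ.injective.iterate k this).symm
  intro k l h
  have h' : ∀ x, D.φ^[k] (D.ι x) = D.φ^[l] (D.ι x) := fun x ↦ by
    simpa using DFunLike.congr_fun h x
  by_contra hkl
  rcases lt_or_gt_of_ne hkl with hkl | hkl
  · exact key k l hkl h'
  · exact key l k hkl fun x ↦ (h' x).symm

theorem eq_zero_of_sum_basisE {c : Fin d → Ω} (hc : ∀ j, D.φ (c j) = c j)
    (h : ∑ j, c j * D.ι (D.basisE j) = 0) : c = 0 := by
  by_contra hc0
  let M : Matrix (Fin d) (Fin d) Ω := fun k j ↦ D.φ^[k] (D.ι (D.basisE j))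
  have hM : M.mulVec c = 0 := by
    funext k
    have := congrArg (D.φ ^ (k : ℕ)) h
    rw [map_zero, map_sum] at this
    rw [Pi.zero_apply, ← this]
    change ∑ j, M k j * c j = _
    refine Finset.sum_congr rfl fun j _ ↦ ?_
    rw [map_mul, RingHom.coe_pow, Function.iterate_fixed (hc j), mul_comm]
  have hdet := Matrix.exists_mulVec_eq_zero_iff.mp ⟨c, hc0, hM⟩
  obtain ⟨w, hw0, hw⟩ := Matrix.exists_vecMul_eq_zero_iff.mpr hdet
  have hli := (linearIndependent_monoidHom E Ω).comp _ D.iterate_φ_ι_injective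
  refine hw0 (funext fun k ↦ Fintype.linearIndependent_iff.mp hli w (funext fun x ↦ ?_) k)
  have hb := fun j ↦ congrFun hw j
  simp only [Finset.sum_apply, Pi.smul_apply, smul_eq_mul, Function.comp_apply, Pi.zero_apply]
  rw [← D.basisE.sum_repr x]
  have hx : ∀ k : Fin d, ((D.φ ^ (k : ℕ)).comp (D.ι : E →+* Ω) : E →* Ω)
      (∑ j, D.basisE.repr x j • D.basisE j) = ∑ j, D.basisE.repr x j • M k j := by
    intro k
    change ((D.φ ^ (k : ℕ)).comp (D.ι : E →+* Ω)) _ = _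
    rw [map_sum]
    refine Finset.sum_congr rfl fun j _ ↦ ?_
    rw [map_rat_smul]
    congr 1
  simp only [hx, Finset.mul_sum]
  rw [Finset.sum_comm]
  refine Finset.sum_eq_zero fun j _ ↦ ?_
  have : ∑ k, w k * M k j = 0 := hb j
  simp only [mul_smul_comm]
  rw [← Finset.smul_sum, this, smul_zero]

section BaseChange

variable {K : Type} [Field K] [Algebra ℚ K] (j : K →ₐ[ℚ] Ω) (hj : ∀ x, D.φ (j x) = j x)

/-- The action of the base-changed cyclic algebra on the space of functions. -/
noncomputable def baseChange : K ⊗[ℚ] D.cyclicAlgebra →ₐ[ℚ] Module.End ℚ D.Space :=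
  Algebra.TensorProduct.lift (D.mulOp.comp j) D.cyclicAlgebra.val fun x y ↦ by
    obtain ⟨_, e, rfl⟩ := y
    change Commute (D.mulOp (j x)) (D.op _)
    refine Commute.sum_right _ _ _ fun i _ ↦ Commute.mul_right ?_ (D.φ_mulOp_commute (hj x) _)
    rw [commute_iff_eq, ← map_mul, ← map_mul, mul_comm]

theorem baseChange_tmul (x : K) (y : D.cyclicAlgebra) :
    D.baseChange j hj (x ⊗ₜ y) = D.mulOp (j x) * y := by
  simp [baseChange]

/-- The coefficients of an element of the base-changed cyclic algebra. -/
noncomputable def coeff (t : K ⊗[ℚ] D.cyclicAlgebra) (i : Fin d) (l : Fin d) : K :=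
  (Algebra.TensorProduct.basis K D.basis).repr t ⟨i, l⟩

theorem sum_coeff (t : K ⊗[ℚ] D.cyclicAlgebra) :
    t = ∑ i, ∑ l, D.coeff t i l ⊗ₜ D.basis ⟨i, l⟩ := by
  conv_lhs => rw [← (Algebra.TensorProduct.basis K D.basis).sum_repr t]
  rw [Fintype.sum_sigma]
  simp [coeff, Algebra.TensorProduct.basis_apply, TensorProduct.smul_tmul']

theorem baseChange_eq (t : K ⊗[ℚ] D.cyclicAlgebra) :
    D.baseChange j hj t = D.op fun i ↦ ∑ l, j (D.coeff t i l) * D.ι (D.basisE l) := by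
  conv_lhs => rw [D.sum_coeff t]
  simp only [map_sum, baseChange_tmul, coe_basis, op, Finset.sum_mul, map_mul, mul_assoc]

theorem baseChange_apply_ne_zero {t : K ⊗[ℚ] D.cyclicAlgebra} (ht : t ≠ 0) {f : D.Space}
    (hf : f ≠ 0) : D.baseChange j hj t f ≠ 0 := by
  rw [baseChange_eq]
  refine D.op_apply_ne_zero (fun h ↦ ht ?_) hf
  rw [D.sum_coeff t]
  refine Finset.sum_eq_zero fun i _ ↦ Finset.sum_eq_zero fun l _ ↦ ?_
  have := D.eq_zero_of_sum_basisE (c := fun l ↦ j (D.coeff t i l)) (fun l ↦ hj _) (congrFun h i)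
  have h0 : D.coeff t i l = 0 := by simpa using congrFun this l
  rw [h0, zero_tmul]

theorem baseChange_injective : Function.Injective (D.baseChange j hj) := by
  obtain ⟨f, hf⟩ := D.exists_space_ne_zero
  rw [injective_iff_map_eq_zero]
  intro t h
  by_contra ht
  exact D.baseChange_apply_ne_zero j hj ht hf (by rw [h]; rfl)

include j hj in
theorem isUnit_of_ne_zero (t : K ⊗[ℚ] D.cyclicAlgebra) (ht : t ≠ 0) : IsUnit t := by
  have := D.finiteDimensional_cyclicAlgebra
  have hinj : Function.Injective (LinearMap.mulLeft K t) := by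
    rw [injective_iff_map_eq_zero]
    intro s hs
    by_contra hs0
    obtain ⟨f, hf⟩ := D.exists_space_ne_zero
    have h1 := D.baseChange_apply_ne_zero j hj ht (D.baseChange_apply_ne_zero j hj hs0 hf)
    rw [← Module.End.mul_apply, ← map_mul, show t * s = 0 from hs, map_zero] at h1
    exact h1 rfl
  obtain ⟨s, hs⟩ := LinearMap.surjective_of_injective hinj 1
  have hs : t * s = 1 := hs
  have hst : s * t = 1 := by
    refine hinj ?_
    change t * (s * t) = t * 1
    rw [← mul_assoc, hs, one_mul, mul_one]
  exact ⟨⟨t, s, hs, hst⟩, rfl⟩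

include j hj in
theorem center_le_bot : Subalgebra.center K (K ⊗[ℚ] D.cyclicAlgebra) ≤ ⊥ := by
  intro t ht
  rw [Subalgebra.mem_center_iff] at ht
  have hcomm : ∀ y : D.cyclicAlgebra, (y : Module.End ℚ D.Space) * D.baseChange j hj t =
      D.baseChange j hj t * y := by
    intro y
    have := congrArg (D.baseChange j hj) (ht (1 ⊗ₜ y))
    simpa [baseChange_tmul] using this
  let i₀ : Fin d := ⟨0, D.pos⟩
  obtain ⟨z, hz⟩ : ∃ z : Fin d → Ω, z = fun i ↦ ∑ l, j (D.coeff t i l) * D.ι (D.basisE l) :=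
    ⟨_, rfl⟩
  have hop : D.baseChange j hj t = D.op z := by rw [baseChange_eq, hz]
  have hz0 : ∀ i, i ≠ i₀ → z i = 0 := by
    intro i hi
    have hi0 : 0 < (i : ℕ) := Nat.pos_of_ne_zero fun h ↦ hi (Fin.ext h)
    obtain ⟨x, hx⟩ := D.faithful i hi0 i.2
    have h1 := hcomm ⟨D.mulOp (D.ι x), D.mulOp_mem x⟩
    rw [hop] at h1
    have h2 : D.op (fun i ↦ D.ι x * z i) = D.op (fun i ↦ z i * D.φ^[i] (D.ι x)) := by
      calc _ = D.mulOp (D.ι x) * D.op z := by simp [op, Finset.mul_sum, mul_assoc]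
        _ = D.op z * D.mulOp (D.ι x) := h1
        _ = _ := by simp [op, Finset.sum_mul, mul_assoc, shift_pow_mul_mulOp]
    have h3 := congrFun (D.op_injective h2) i
    by_contra hzi
    rw [mul_comm] at h3
    exact hx (mul_left_cancel₀ hzi h3).symm
  have hopz : D.op z = D.mulOp (z i₀) := by
    rw [op, Finset.sum_eq_single i₀]
    · simp [i₀]
    · intro i _ hi
      simp [hz0 i hi]
    · simp
  have hφz : D.φ (z i₀) = z i₀ := by
    obtain ⟨f, hf⟩ := D.exists_space_ne_zero
    obtain ⟨n, hn⟩ : ∃ n, f.1 n ≠ 0 := by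
      by_contra! h
      exact hf (Space.ext h)
    have h1 := hcomm ⟨D.shift, D.shift_mem⟩
    rw [hop, hopz] at h1
    have h2 : D.φ (z i₀ * f.1 (n + 1 - 1)) = z i₀ * D.φ (f.1 (n + 1 - 1)) :=
      congrFun (congrArg Subtype.val (LinearMap.congr_fun h1 f)) (n + 1)
    rw [map_mul, add_sub_cancel_right] at h2
    exact mul_right_cancel₀ ((map_ne_zero D.φ).mpr hn) h2
  let a := D.basisE.repr 1
  have ha : ∑ l, (a l : Ω) * D.ι (D.basisE l) = 1 := by
    rw [← map_one D.ι, ← D.basisE.sum_repr 1, map_sum]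
    refine Finset.sum_congr rfl fun l _ ↦ ?_
    rw [map_rat_smul, Rat.smul_def]
  have hc : ∀ l, j (D.coeff t i₀ l) = z i₀ * a l := by
    intro l
    have := D.eq_zero_of_sum_basisE (c := fun l ↦ j (D.coeff t i₀ l) - z i₀ * a l)
      (fun l ↦ by simp [hj, hφz]) (by
        simp only [sub_mul, Finset.sum_sub_distrib, mul_assoc]
        rw [← Finset.mul_sum, ha, mul_one, sub_eq_zero]
        exact (congrFun hz i₀).symm)
    exact sub_eq_zero.mp (congrFun this l)
  obtain ⟨l, hl⟩ : ∃ l, a l ≠ 0 := by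
    by_contra! h
    simp [h] at ha
  have hk : j (D.coeff t i₀ l / (algebraMap ℚ K (a l))) = z i₀ := by
    rw [map_div₀, hc, AlgHom.commutes, eq_ratCast, mul_div_cancel_right₀]
    exact_mod_cast hl
  refine Algebra.mem_bot.mpr ⟨D.coeff t i₀ l / (algebraMap ℚ K (a l)), ?_⟩
  refine D.baseChange_injective j hj ?_
  rw [hop, hopz, Algebra.TensorProduct.algebraMap_apply, baseChange_tmul]
  simp [← hk]

end BaseChange

theorem cyclicAlgebra_center_le_bot : Subalgebra.center ℚ D.cyclicAlgebra ≤ ⊥ := by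
  intro y hy
  let e := Algebra.TensorProduct.lid ℚ D.cyclicAlgebra
  have h : e.symm y ∈ Subalgebra.center ℚ (ℚ ⊗[ℚ] D.cyclicAlgebra) := by
    rw [Subalgebra.mem_center_iff] at hy ⊢
    intro b
    refine e.injective ?_
    simp only [map_mul, AlgEquiv.apply_symm_apply]
    exact hy _
  obtain ⟨q, hq⟩ := Algebra.mem_bot.mp (D.center_le_bot (Algebra.ofId ℚ Ω) (by simp) h)
  refine Algebra.mem_bot.mpr ⟨q, ?_⟩
  rw [← e.apply_symm_apply y, ← hq, AlgEquiv.commutes]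

theorem nontrivial_cyclicAlgebra : Nontrivial D.cyclicAlgebra :=
  have : Nonempty (Fin d) := ⟨⟨0, D.pos⟩⟩
  have : Nontrivial (Fin d → E) := inferInstance
  D.coeffEquiv.injective.nontrivial

theorem isUnit_cyclicAlgebra (y : D.cyclicAlgebra) (hy : y ≠ 0) : IsUnit y := by
  let e := Algebra.TensorProduct.lid ℚ D.cyclicAlgebra
  have := D.isUnit_of_ne_zero (Algebra.ofId ℚ Ω) (by simp) (e.symm y) (by simpa using hy)
  simpa using this.map e

end FrobeniusData

end

section

open WithZero

theorem exists_frobeniusData_of_aut {p d : ℕ} (hd : 0 < d) {Ω C : Type} [Field Ω] [CharZero Ω]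
    [Field C] [CharZero C] [FiniteDimensional ℚ C] [IsGalois ℚ C] (f : Ω →+* Ω)
    (v : Valuation Ω ℤᵐ⁰) (v_f : ∀ x, v (f x) = v x) (v_p : v (p : Ω) = exp (-1))
    (ι : C →+* Ω) (τ : Gal(C/ℚ)) (hτ : ∀ g, g ∈ Subgroup.zpowers τ) (hdvd : d ∣ orderOf τ)
    (hf : ∀ x, f (ι x) = ι (τ x)) :
    ∃ (Ω' E : Type) (_ : Field Ω') (_ : CharZero Ω') (_ : Field E) (_ : CharZero E)
      (D : FrobeniusData p d Ω' E), ∀ (F : Type) [Field F] (j : F →+* Ω), (∀ x, f (j x) = j x) →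
        ∃ j' : F →+* Ω', ∀ x, D.φ (j' x) = j' x := by
  let S : Subfield Ω := (f ^ d).eqLocusField (RingHom.id Ω)
  have hS : ∀ x, x ∈ S ↔ f^[d] x = x := fun x ↦ by
    rw [← RingHom.coe_pow]
    rfl
  have hfS : ∀ x ∈ S, f x ∈ S := fun x hx ↦ by
    rw [hS] at hx ⊢
    rw [← Function.iterate_succ_apply, Function.iterate_succ_apply', hx]
  have hfι : ∀ i x, f^[i] (ι x) = ι ((τ ^ i) x) := by
    intro i
    induction i with
    | zero => intro x; rfl
    | succ i ih => intro x; rw [Function.iterate_succ_apply, hf, ih, pow_succ]; rfl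
  let φ : S →+* S := f.restrict S S hfS
  have hφ : ∀ i (x : S), ((φ^[i] x : S) : Ω) = f^[i] x := by
    intro i
    induction i with
    | zero => intro x; rfl
    | succ i ih => intro x; rw [Function.iterate_succ_apply, ih, Function.iterate_succ_apply]; rfl
  let H := Subgroup.zpowers (τ ^ d)
  let E := IntermediateField.fixedField H
  have hE : ∀ x, x ∈ E ↔ (τ ^ d) x = x := by
    intro x
    rw [IntermediateField.mem_fixedField_iff]
    refine ⟨fun h ↦ h _ (Subgroup.mem_zpowers _), fun h g hg ↦ ?_⟩
    have : H ≤ MulAction.stabilizer Gal(C/ℚ) x := by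
      rw [Subgroup.zpowers_le]
      exact h
    exact this hg
  have hτE : ∀ x ∈ E, τ x ∈ E := by
    intro x hx
    rw [hE] at hx ⊢
    rw [← AlgEquiv.mul_apply, ← pow_succ, pow_succ', AlgEquiv.mul_apply, hx]
  have hιS : ∀ x : E, ι x ∈ S := fun x ↦ by
    rw [hS, hfι, (hE x).mp x.2]
  have hord : 0 < orderOf τ := orderOf_pos τ
  have hrank : Module.finrank ℚ E = d := by
    have h1 : Module.finrank E C = orderOf τ / d := by
      rw [IntermediateField.finrank_fixedField_eq_card, Nat.card_zpowers,
        orderOf_pow_of_dvd hd.ne' hdvd]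
    have h2 : Module.finrank ℚ C = orderOf τ := by
      rw [← IsGalois.card_aut_eq_finrank, orderOf_eq_card_of_forall_mem_zpowers hτ]
    have h3 := Module.finrank_mul_finrank ℚ E C
    rw [h1, h2] at h3
    obtain ⟨k, hk⟩ := hdvd
    rw [hk, Nat.mul_div_cancel_left _ hd] at h3
    have : 0 < k := Nat.pos_of_mul_pos_left (hk ▸ hord)
    exact Nat.eq_of_mul_eq_mul_right this h3
  have hfaith : ∀ i, 0 < i → i < d → ∃ x : E, (τ ^ i) (x : C) ≠ x := by
    intro i hi hid
    by_contra! h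
    have h1 : τ ^ i ∈ IntermediateField.fixingSubgroup E := by
      rw [IntermediateField.mem_fixingSubgroup_iff]
      exact fun x hx ↦ h ⟨x, hx⟩
    rw [IntermediateField.fixingSubgroup_fixedField] at h1
    obtain ⟨k, hk⟩ := Subgroup.mem_zpowers_iff.mp h1
    have h2 : τ ^ ((d : ℤ) * k) = τ ^ (i : ℤ) := by
      rw [zpow_mul, zpow_natCast, zpow_natCast, hk]
    rw [zpow_eq_zpow_iff_modEq] at h2
    have h3 := h2.of_dvd (show ((d : ℕ) : ℤ) ∣ (orderOf τ : ℤ) by exact_mod_cast hdvd)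
    have h4 : (d : ℤ) ∣ i := (Int.modEq_zero_iff_dvd.mp (h3.symm.trans
      (Int.modEq_zero_iff_dvd.mpr (dvd_mul_right _ _))))
    have := Nat.le_of_dvd hi (by exact_mod_cast h4)
    omega
  have : CharZero S := S.subtype.charZero
  have : CharZero E := inferInstance
  let ιE : E →+* S := (ι.comp (algebraMap E C)).codRestrict S hιS
  refine ⟨S, E, inferInstance, inferInstance, inferInstance, inferInstance,
    { pos := hd
      φ := φ
      iterate_φ := fun x ↦ Subtype.ext (by rw [hφ]; exact (hS x).mp x.2)
      v := v.comap S.subtype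
      v_φ := fun x ↦ v_f x
      v_p := by simpa using v_p
      ι := ιE.toRatAlgHom
      σ := fun x ↦ ⟨τ x, hτE x x.2⟩
      φ_ι := fun x ↦ Subtype.ext (hf x)
      finrank_eq := by convert hrank
      faithful := fun i hi hid ↦ by
        obtain ⟨x, hx⟩ := hfaith i hi hid
        refine ⟨x, fun h ↦ hx ?_⟩
        have := congrArg Subtype.val h
        rw [hφ] at this
        exact ι.injective ((hfι i x).symm.trans this) }, ?_⟩
  intro F _ j hj
  refine ⟨j.codRestrict S fun x ↦ (hS _).mpr (Function.iterate_fixed (hj x) d), fun x ↦ ?_⟩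
  exact Subtype.ext (hj x)

end

section

open WithZero Polynomial

theorem exists_prime_generator {d : ℕ} (hd : 0 < d) : ∃ (q p : ℕ) (_ : Fact q.Prime)
    (_ : Fact p.Prime) (g : (ZMod q)ˣ), d ∣ q - 1 ∧ q ≠ p ∧ p % 4 = 1 ∧ (p : ZMod q) = g ∧
      ∀ x, x ∈ Subgroup.zpowers g := by
  obtain ⟨q, hq, hq2, hqd⟩ := Nat.exists_prime_gt_modEq_one 2 hd.ne'
  have : Fact q.Prime := ⟨hq⟩
  obtain ⟨g, hg⟩ := IsCyclic.exists_generator (α := (ZMod q)ˣ)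
  have hco : Nat.Coprime 4 q := by
    rw [show 4 = 2 ^ 2 by rfl]
    exact Nat.Coprime.pow_left _ ((Nat.coprime_primes Nat.prime_two hq).mpr hq2.ne)
  let a := Nat.chineseRemainder hco 1 (g : ZMod q).val
  have ha : (a : ℕ).Coprime (4 * q) := by
    refine Nat.Coprime.mul_right ?_ ?_
    · rw [Nat.coprime_iff_gcd_eq_one, a.2.1.gcd_eq, Nat.gcd_one_left]
    · rw [Nat.coprime_iff_gcd_eq_one, a.2.2.gcd_eq]
      exact ZMod.val_coe_unit_coprime g
  obtain ⟨p, hpq, hp, hpa⟩ := Nat.forall_exists_prime_gt_and_modEq q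
    (mul_ne_zero four_ne_zero hq.ne_zero) ha
  refine ⟨q, p, ⟨hq⟩, ⟨hp⟩, g, (Nat.modEq_iff_dvd' hq.one_le).mp hqd.symm, hpq.ne,
    (hpa.of_mul_right q).trans a.2.1, ?_, hg⟩
  have h := (hpa.of_mul_left 4).trans a.2.2
  rw [← ZMod.natCast_eq_natCast_iff] at h
  rw [h, ZMod.natCast_val, ZMod.cast_id', id]

theorem exists_aut_of_cyclotomic {q p : ℕ} [Fact q.Prime] {g : (ZMod q)ˣ}
    (hpg : (p : ZMod q) = g) (hg : ∀ x, x ∈ Subgroup.zpowers g) {C Ω : Type} [Field C]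
    [Algebra ℚ C] [IsCyclotomicExtension {q} ℚ C] [Field Ω] [CharZero Ω] (f : Ω →+* Ω) {ζ : Ω}
    (hζ : IsPrimitiveRoot ζ q) (hfζ : f ζ = ζ ^ p) :
    ∃ (ι : C →+* Ω) (τ : Gal(C/ℚ)), (∀ x, x ∈ Subgroup.zpowers τ) ∧ orderOf τ = q - 1 ∧
      ∀ x, f (ι x) = ι (τ x) := by
  have hq : q.Prime := Fact.out
  have : NeZero q := ⟨hq.ne_zero⟩
  have hirr := cyclotomic.irreducible_rat hq.pos
  have hz := IsCyclotomicExtension.zeta_spec q ℚ C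
  let e := IsCyclotomicExtension.autEquivPow C hirr
  have hτz : e.symm g (IsCyclotomicExtension.zeta q ℚ C) =
      IsCyclotomicExtension.zeta q ℚ C ^ p := by
    have h1 : hz.autToPow ℚ (e.symm g) = g := e.apply_symm_apply g
    have h2 := hz.autToPow_spec ℚ (e.symm g)
    rw [h1] at h2
    rw [← h2, ← hpg, ZMod.val_natCast, ← pow_eq_pow_mod p hz.pow_eq_one]
  have hroot : aeval ζ (minpoly ℚ (hz.powerBasis ℚ).gen) = 0 := by
    rw [IsPrimitiveRoot.powerBasis_gen, ← hz.minpoly_eq_cyclotomic_of_irreducible hirr,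
      aeval_def, eval₂_eq_eval_map, map_cyclotomic]
    exact hζ.isRoot_cyclotomic hq.pos
  let ι : C →ₐ[ℚ] Ω := (hz.powerBasis ℚ).lift ζ hroot
  have hι : ι (IsCyclotomicExtension.zeta q ℚ C) = ζ :=
    (congrArg ι (hz.powerBasis_gen ℚ)).symm.trans ((hz.powerBasis ℚ).lift_gen ζ hroot)
  refine ⟨ι, e.symm g, fun x ↦ ?_, ?_, fun x ↦ ?_⟩
  · obtain ⟨n, hn⟩ := Subgroup.mem_zpowers_iff.mp (hg (e x))
    exact Subgroup.mem_zpowers_iff.mpr ⟨n, by rw [← map_zpow, hn, e.symm_apply_apply]⟩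
  · rw [MulEquiv.orderOf_eq, orderOf_eq_card_of_forall_mem_zpowers hg, Nat.card_eq_fintype_card,
      ZMod.card_units]
  · have : (f.toRatAlgHom).comp ι = ι.comp (e.symm g : C →ₐ[ℚ] C) := by
      refine (hz.powerBasis ℚ).algHom_ext ?_
      rw [IsPrimitiveRoot.powerBasis_gen]
      change f (ι _) = ι (e.symm g _)
      rw [hτz, map_pow, hι, hfζ]
    exact DFunLike.congr_fun this x

theorem WittBar.exists_algHom_splittingField (p : ℕ) [Fact p.Prime] (hp : p % 4 = 1)
    [CharZero (FractionRing (WittBar p))] :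
    ∃ j : (quintic ℚ (3 * p + 1) (2 * p)).SplittingField →+* FractionRing (WittBar p),
      ∀ x, frob p (j x) = j x := by
  obtain ⟨hs, hfix⟩ := WittBar.splits_quintic p hp
  set P := quintic ℚ (3 * p + 1) (2 * p)
  let j := SplittingField.lift P (L := FractionRing (WittBar p)) (by simpa [P] using hs)
  refine ⟨j, fun x ↦ ?_⟩
  have : ((frob p).toRingHom.toRatAlgHom).comp j = j := by
    refine AlgHom.ext_of_adjoin_eq_top (SplittingField.adjoin_rootSet P) fun y hy ↦ hfix (j y) ?_
    have h0 : aeval (j y) P = 0 := by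
      rw [aeval_algHom_apply]
      exact (congrArg j (aeval_eq_zero_of_mem_rootSet hy)).trans (map_zero j)
    rwa [aeval_def, eval₂_eq_eval_map, quintic_map] at h0
  exact DFunLike.congr_fun this x

theorem exists_frobeniusData {d : ℕ} (hd : 0 < d) :
    ∃ p : ℕ, p.Prime ∧ p % 4 = 1 ∧ ∃ (Ω E : Type) (_ : Field Ω) (_ : CharZero Ω) (_ : Field E)
      (_ : CharZero E) (D : FrobeniusData p d Ω E)
      (j : (quintic ℚ (3 * p + 1) (2 * p)).SplittingField →+* Ω), ∀ x, D.φ (j x) = j x := by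
  obtain ⟨q, p, _, _, g, hdq, hqp, hp4, hpg, hg⟩ := exists_prime_generator hd
  have : NeZero q := ⟨(Fact.out : q.Prime).ne_zero⟩
  have : CharZero (FractionRing (WittBar p)) := inferInstance
  obtain ⟨ζ, hζ, hfζ⟩ := WittBar.exists_primitiveRoot p (Fact.out : q.Prime) hqp
  have : IsCyclotomicExtension {q} ℚ (CyclotomicField q ℚ) := by
    convert CyclotomicField.isCyclotomicExtension q ℚ
    · rfl
    · exact Subsingleton.elim _ _
  obtain ⟨ι, τ, hτ, hord, hf⟩ := exists_aut_of_cyclotomic (C := CyclotomicField q ℚ) hpg hg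
    (WittBar.frob p).toRingHom hζ hfζ
  have := IsCyclotomicExtension.isGalois {q} ℚ (CyclotomicField q ℚ)
  obtain ⟨Ω, E, _, _, _, _, D, hD⟩ := exists_frobeniusData_of_aut hd (WittBar.frob p).toRingHom
    ((IsDiscreteValuationRing.maximalIdeal (WittBar p)).valuation _) (WittBar.valuation_frob p)
    (WittBar.valuation_p p) ι τ hτ (hord ▸ hdq) hf
  obtain ⟨j, hj⟩ := WittBar.exists_algHom_splittingField p hp4
  obtain ⟨j', hj'⟩ := hD _ j hj
  exact ⟨p, Fact.out, hp4, Ω, E, _, _, _, _, D, j', hj'⟩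

end

section

open TensorProduct

namespace FrobeniusData

variable {p d : ℕ} {Ω E : Type} [Field Ω] [CharZero Ω] [Field E] [CharZero E]
  (D : FrobeniusData p d Ω E)

theorem nontrivial_baseChange {K : Type} [Field K] [Algebra ℚ K] (j : K →ₐ[ℚ] Ω)
    (hj : ∀ x, D.φ (j x) = j x) : Nontrivial (K ⊗[ℚ] D.cyclicAlgebra) := by
  obtain ⟨f, hf⟩ := D.exists_space_ne_zero
  refine ⟨1, 0, fun h ↦ hf ?_⟩
  have h1 := congrArg (D.baseChange j hj) h
  rw [map_one, map_zero] at h1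
  exact LinearMap.congr_fun h1 f

/-- The base change of the cyclic algebra as a central simple algebra. -/
noncomputable def csAlg {K : Type} [Field K] [Algebra ℚ K] (j : K →ₐ[ℚ] Ω)
    (hj : ∀ x, D.φ (j x) = j x) : CSAlg K where
  carrier := K ⊗[ℚ] D.cyclicAlgebra
  finiteDimensional :=
    have := D.finiteDimensional_cyclicAlgebra
    inferInstance
  isSimpleRing :=
    have := D.nontrivial_baseChange j hj
    isSimpleRing_of_isUnit (D.isUnit_of_ne_zero j hj)
  center_le_bot := D.center_le_bot j hj

/-- The cyclic algebra as a central simple algebra. -/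
noncomputable def csAlgRat : CSAlg ℚ where
  carrier := D.cyclicAlgebra
  finiteDimensional := D.finiteDimensional_cyclicAlgebra
  isSimpleRing :=
    have := D.nontrivial_cyclicAlgebra
    isSimpleRing_of_isUnit D.isUnit_cyclicAlgebra
  center_le_bot := D.cyclicAlgebra_center_le_bot

theorem isDivision_csAlg {K : Type} [Field K] [Algebra ℚ K] (j : K →ₐ[ℚ] Ω)
    (hj : ∀ x, D.φ (j x) = j x) : (D.csAlg j hj).IsDivision :=
  D.isUnit_of_ne_zero j hj

theorem degreeEq_csAlg {K : Type} [Field K] [Algebra ℚ K] (j : K →ₐ[ℚ] Ω)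
    (hj : ∀ x, D.φ (j x) = j x) : (D.csAlg j hj).DegreeEq d :=
  Module.finrank_baseChange.trans D.finrank_cyclicAlgebra

theorem inFiber_csAlg {K : Type} [Field K] [Algebra ℚ K] (j : K →ₐ[ℚ] Ω)
    (hj : ∀ x, D.φ (j x) = j x) : InFiber ℚ K (D.csAlg j hj) D.csAlgRat :=
  ⟨1, 1, one_pos, one_pos, ⟨AlgEquiv.refl⟩⟩

theorem inFiber_of_coprime {K K' L₁ L₂ : Type} [Field K] [Field K'] [Field L₁] [Field L₂]
    [Algebra ℚ K] [Algebra ℚ K'] [Algebra ℚ L₁] [Algebra ℚ L₂] [FiniteDimensional ℚ K']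
    [FiniteDimensional ℚ L₁] [FiniteDimensional ℚ L₂] (j : K →ₐ[ℚ] Ω) (hj : ∀ x, D.φ (j x) = j x)
    (j' : K' →ₐ[ℚ] Ω) (hj' : ∀ x, D.φ (j' x) = j' x)
    (i₁ : K →ₐ[ℚ] L₁) (i₂ : K →ₐ[ℚ] L₂) (j₁ : K' →ₐ[ℚ] L₁) (j₂ : K' →ₐ[ℚ] L₂)
    {a b : ℕ} (hab : a.Coprime b)
    (h₁ : Module.finrank ℚ L₁ = a * Module.finrank ℚ K')
    (h₂ : Module.finrank ℚ L₂ = b * Module.finrank ℚ K') (B : CSAlg ℚ)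
    (h : InFiber ℚ K (D.csAlg j hj) B) : InFiber ℚ K' (D.csAlg j' hj') B :=
  have := B.finiteDimensional
  have := B.isSimpleRing
  have := D.finiteDimensional_cyclicAlgebra
  have := D.nontrivial_cyclicAlgebra
  IsBrauerEquiv.of_coprime B.center_le_bot (D.isUnit_of_ne_zero j' hj') i₁ i₂ j₁ j₂ hab h₁ h₂ h

end FrobeniusData

theorem isGalois_splittingField {k : Type} [Field k] {P : Polynomial k} (h : P.Separable) :
    IsGalois k P.SplittingField :=
  IsGalois.of_separable_splitting_field h

theorem exists_numField_of_galois {p d : ℕ} {Ω E : Type} [Field Ω] [CharZero Ω] [Field E]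
    [CharZero E] (D : FrobeniusData p d Ω E) {F : Type} [Field F] [CharZero F]
    [alg : Algebra ℚ F] [FiniteDimensional ℚ F] [IsGalois ℚ F]
    (e : Gal(F/ℚ) ≃* Equiv.Perm (Fin 5)) (j : F →+* Ω) (hj : ∀ x, D.φ (j x) = j x) :
    ∃ K K' : NumField, IsEmpty (K.carrier ≃+* K'.carrier) ∧
      ∃ (A : CSAlg K.carrier) (A' : CSAlg K'.carrier),
        A.IsDivision ∧ A.DegreeEq d ∧ A'.IsDivision ∧ A'.DegreeEq d ∧
        (∀ B : CSAlg ℚ, InFiber ℚ K.carrier A B ↔ InFiber ℚ K'.carrier A' B) ∧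
        ∃ B₀ : CSAlg ℚ, InFiber ℚ K.carrier A B₀ ∧ InFiber ℚ K'.carrier A' B₀ := by
  obtain rfl : alg = DivisionRing.toRatAlgebra := Subsingleton.elim _ _
  have : NumberField F := {}
  obtain ⟨K, K', L₁, L₂, hK, ⟨i₁⟩, ⟨i₂⟩, ⟨j₁⟩, ⟨j₂⟩, h₁, h₂, h⟩ :=
    exists_intermediateFields_of_galois_perm e
  let N (K : IntermediateField ℚ F) : NumField := { carrier := K }
  let ι (K : IntermediateField ℚ F) : (N K).carrier →ₐ[ℚ] Ω :=
    (j.comp (algebraMap K F)).toRatAlgHom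
  have hι (K : IntermediateField ℚ F) (x) : D.φ (ι K x) = ι K x := hj _
  refine ⟨N K, N K', hK, D.csAlg (ι K) (hι K), D.csAlg (ι K') (hι K'), D.isDivision_csAlg _ _,
    D.degreeEq_csAlg _ _, D.isDivision_csAlg _ _, D.degreeEq_csAlg _ _, fun B ↦ ⟨?_, ?_⟩,
    D.csAlgRat, D.inFiber_csAlg _ _, D.inFiber_csAlg _ _⟩
  · exact D.inFiber_of_coprime _ _ _ _ i₁.toRingHom.toRatAlgHom i₂.toRingHom.toRatAlgHom
      j₁.toRingHom.toRatAlgHom j₂.toRingHom.toRatAlgHom (a := 2) (b := 3) (by norm_num)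
      (by rw [h]; convert h₁) (by convert h₂) B
  · exact D.inFiber_of_coprime _ _ _ _ j₁.toRingHom.toRatAlgHom j₂.toRingHom.toRatAlgHom
      i₁.toRingHom.toRatAlgHom i₂.toRingHom.toRatAlgHom (a := 2) (b := 3) (by norm_num)
      (by convert h₁) (by convert h₂) B

end

/-- For every integer `d ≥ 2`, there exist non-isomorphic number fields
`K, K'`, a central division algebra `A` of degree `d` over `K` and a central division
algebra `A'` of degree `d` over `K'`, such that a finite-dimensional central simple
`ℚ`-algebra `B` lies in `(Res_{K/ℚ})⁻¹(A)` iff it lies in `(Res_{K'/ℚ})⁻¹(A')`, and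
some `B₀` lies in both fibers. -/
theorem stmt_0 (d : ℕ) (hd : 2 ≤ d) :
    ∃ (K K' : NumField), IsEmpty (K.carrier ≃+* K'.carrier) ∧
      ∃ (A : CSAlg K.carrier) (A' : CSAlg K'.carrier),
        A.IsDivision ∧ A.DegreeEq d ∧ A'.IsDivision ∧ A'.DegreeEq d ∧
        (∀ B : CSAlg ℚ, InFiber ℚ K.carrier A B ↔ InFiber ℚ K'.carrier A' B) ∧
        ∃ B₀ : CSAlg ℚ, InFiber ℚ K.carrier A B₀ ∧ InFiber ℚ K'.carrier A' B₀ := by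
  obtain ⟨p, hp, hp4, Ω, E, _, _, _, _, D, j, hj⟩ := exists_frobeniusData (by omega : 0 < d)
  have hirr := quintic_irreducible (3 * p + 1) (2 * p) (by omega) (dvd_mul_right 2 p) (by omega)
  obtain ⟨e⟩ := nonempty_gal_quintic_mulEquiv (3 * p + 1) (2 * p) hirr (by have := hp.pos; omega)
    (by have := hp.pos; omega)
  have := isGalois_splittingField hirr.separable
  exact exists_numField_of_galois (alg := _) D e j hj
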